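/- There exist constants K ≥ 1 and C with the following property. Let ε > 0, and let (v,p,R) be a uniformly continuous weak solution of the Euler–Reynolds system on ℝ×𝕋³ with v uniformly bounded and supp R ⊆ I×𝕋³ for some union of time intervals I, and suppose ‖R‖_{C⁰} ≤ e_R. Let e : ℝ → [0,∞) be a function with e(t) ≥ K e_R for all t in a neighborhood of I, e(t) ≤ 1000·K·e_R for all t, and such that (d/dt)e^{1/2} exists, is continuous, and is uniformly bounded on ℝ. Then there exists a uniformly continuous weak solution (v₁,p₁,R₁) of the Euler–Reynolds system on ℝ×𝕋³ of the form v₁ = v+V, p₁ = p+P, such that: supp V ∪ supp P ∪ supp R₁ ⊆ (supp e)×𝕋³; ‖V‖_{C⁰} ≤ C e_R^{1/2}; ‖P‖_{C⁰} ≤ C e_R; sup_t | ∫_{𝕋³}|v₁|²(t,x) dx − ∫_{𝕋³}(|v|²(t,x) + e(t)) dx | ≤ ε; and ‖R₁‖_{C⁰} ≤ ε. -/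

import Mathlib

noncomputable section

open MeasureTheory

/-- Points of space; functions on the torus 𝕋³ = ℝ³/ℤ³ are identified with
ℤ³-periodic functions on ℝ³. -/
abbrev Spc : Type := Fin 3 → ℝ

/-- The fundamental domain [0,1)³ of the torus. -/
def Tdom : Set Spc := Set.univ.pi fun _ => Set.Ico (0 : ℝ) 1

/-- ℤ³-periodicity of a function on ℝ³. -/
def Per {α : Type*} (f : Spc → α) : Prop :=
  ∀ (x : Spc) (k : Fin 3 → ℤ), f (fun i => x i + (k i : ℝ)) = f x

/-- Spatial partial derivative in direction `j`. -/
def pd {E : Type*} [NormedAddCommGroup E] [NormedSpace ℝ E]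
    (j : Fin 3) (f : Spc → E) (x : Spc) : E :=
  fderiv ℝ f x (Pi.single j 1)

/-- Time derivative. -/
def pt {E : Type*} [NormedAddCommGroup E] [NormedSpace ℝ E]
    (f : ℝ → Spc → E) (t : ℝ) (x : Spc) : E :=
  deriv (fun s => f s x) t

/-- Smooth test function on ℝ×𝕋³: smooth, ℤ³-periodic in space and
compactly supported in time. -/
def IsTest {E : Type*} [NormedAddCommGroup E] [NormedSpace ℝ E]
    (φ : ℝ → Spc → E) : Prop :=
  ContDiff ℝ (⊤ : ℕ∞) (fun q : ℝ × Spc => φ q.1 q.2) ∧ (∀ t, Per (φ t)) ∧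
    ∃ T : ℝ, ∀ t : ℝ, T < |t| → ∀ x, φ t x = 0

/-- Weak solution of the incompressible Euler equations on ℝ×𝕋³. -/
def IsWeakEuler (v : ℝ → Spc → Spc) (p : ℝ → Spc → ℝ) : Prop :=
  (∀ φ : ℝ → Spc → Spc, IsTest φ →
    (∫ t : ℝ, ∫ x in Tdom,
      ((∑ l, v t x l * pt (fun s y => φ s y l) t x) +
        (∑ j, ∑ l, v t x j * v t x l * pd j (fun y => φ t y l) x) +
        p t x * ∑ j, pd j (fun y => φ t y j) x)) = 0) ∧
  (∀ ψ : ℝ → Spc → ℝ, IsTest ψ →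
    (∫ t : ℝ, ∫ x in Tdom, ∑ j, v t x j * pd j (ψ t) x) = 0)

/-- Hölder continuity of exponent `α`, jointly in time and space. -/
def HolderTS {E : Type*} [NormedAddCommGroup E] (α : ℝ) (f : ℝ → Spc → E) : Prop :=
  ∃ C : ℝ, ∀ (t t' : ℝ) (x x' : Spc),
    ‖f t x - f t' x'‖ ≤ C * dist ((t, x) : ℝ × Spc) ((t', x') : ℝ × Spc) ^ α

/-- Weak solution of the Euler–Reynolds system
`∂ₜ vˡ + ∂ⱼ(vʲvˡ) + ∂ˡp = ∂ⱼ Rʲˡ`, `∂ⱼ vʲ = 0` on ℝ×𝕋³. -/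
def IsWeakEulerReynolds (v : ℝ → Spc → Spc) (p : ℝ → Spc → ℝ)
    (R : ℝ → Spc → Fin 3 → Fin 3 → ℝ) : Prop :=
  (∀ φ : ℝ → Spc → Spc, IsTest φ →
    (∫ t : ℝ, ∫ x in Tdom,
      ((∑ l, v t x l * pt (fun s y => φ s y l) t x) +
        (∑ j, ∑ l, v t x j * v t x l * pd j (fun y => φ t y l) x) +
        p t x * (∑ j, pd j (fun y => φ t y j) x) -
        (∑ j, ∑ l, R t x j l * pd j (fun y => φ t y l) x))) = 0) ∧
  (∀ ψ : ℝ → Spc → ℝ, IsTest ψ →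
    (∫ t : ℝ, ∫ x in Tdom, ∑ j, v t x j * pd j (ψ t) x) = 0)

namespace CI
open Set Filter Topology

/-- Space-time. -/
abbrev STQ : Type := ℝ × Spc

/-- Directional derivative. -/
def D (w : STQ) (f : STQ → ℝ) : STQ → ℝ := fun q => fderiv ℝ f q w

def eT : STQ := (1, 0)
def eX (j : Fin 3) : STQ := (0, Pi.single j 1)

def PerQ (f : STQ → ℝ) : Prop :=
  ∀ (q : STQ) (k : Fin 3 → ℤ), f (q.1, fun i => q.2 i + (k i : ℝ)) = f q

/-- bounded continuous, periodic, vanishing at times in `O` -/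
structure Bas (O : Set ℝ) (f : STQ → ℝ) : Prop where
  cont : Continuous f
  bdd : ∃ C, ∀ q, |f q| ≤ C
  per : PerQ f
  van : ∀ q : STQ, q.1 ∈ O → f q = 0

def BC (O : Set ℝ) : ℕ → (STQ → ℝ) → Prop
  | 0, f => Bas O f
  | n + 1, f => Bas O f ∧ Differentiable ℝ f ∧ ∀ w, BC O n (D w f)

def SB (O : Set ℝ) (f : STQ → ℝ) : Prop := ∀ n, BC O n f

variable {O : Set ℝ} {f g : STQ → ℝ} {n : ℕ}

lemma BC.bas (h : BC O n f) : Bas O f := by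
  cases n with
  | zero => exact h
  | succ n => exact h.1

lemma BC.down (h : BC O (n + 1) f) : BC O n f := by
  induction n generalizing f with
  | zero => exact h.1
  | succ n ih => exact ⟨h.1, h.2.1, fun w => ih (h.2.2 w)⟩

lemma SB.bas (h : SB O f) : Bas O f := h 0
lemma SB.cont (h : SB O f) : Continuous f := h.bas.cont
lemma SB.diff (h : SB O f) : Differentiable ℝ f := (h 1).2.1
lemma SB.D (h : SB O f) (w : STQ) : SB O (D w f) := fun n => (h (n + 1)).2.2 w

lemma SB.mk' (h : Bas O f) (hd : Differentiable ℝ f) (h' : ∀ w, SB O (CI.D w f)) : SB O f := by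
  intro n
  cases n with
  | zero => exact h
  | succ n => exact ⟨h, hd, fun w => h' w n⟩

lemma Bas.add (hf : Bas O f) (hg : Bas O g) : Bas O (fun q => f q + g q) := by
  obtain ⟨C, hC⟩ := hf.bdd
  obtain ⟨C', hC'⟩ := hg.bdd
  refine ⟨hf.cont.add hg.cont, ⟨C + C', fun q => (abs_add_le _ _).trans (add_le_add (hC q) (hC' q))⟩,
    fun q k => ?_, fun q hq => ?_⟩
  · simp only [hf.per q k, hg.per q k]
  · simp [hf.van q hq, hg.van q hq]

lemma Bas.mul {O' : Set ℝ} (hf : Bas O' f) (hg : Bas O g) : Bas O (fun q => f q * g q) := by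
  obtain ⟨C, hC⟩ := hf.bdd
  obtain ⟨C', hC'⟩ := hg.bdd
  refine ⟨hf.cont.mul hg.cont, ⟨C * C', fun q => ?_⟩, fun q k => ?_, fun q hq => ?_⟩
  · rw [abs_mul]
    exact mul_le_mul (hC q) (hC' q) (abs_nonneg _) ((abs_nonneg _).trans (hC q))
  · simp only [hf.per q k, hg.per q k]
  · simp [hg.van q hq]

lemma D_add (hf : Differentiable ℝ f) (hg : Differentiable ℝ g) (w : STQ) :
    D w (fun q => f q + g q) = fun q => D w f q + D w g q := by
  funext q
  simp only [D]
  rw [fderiv_fun_add (hf q) (hg q)]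
  rfl

lemma D_mul (hf : Differentiable ℝ f) (hg : Differentiable ℝ g) (w : STQ) :
    D w (fun q => f q * g q) = fun q => f q * D w g q + D w f q * g q := by
  funext q
  simp only [D]
  rw [fderiv_fun_mul (hf q) (hg q)]
  simp [mul_comm]

lemma D_const (c : ℝ) (w : STQ) : D w (fun _ => c) = fun _ => 0 := by
  funext q
  simp [D]

lemma BC.add (hf : BC O n f) (hg : BC O n g) : BC O n (fun q => f q + g q) := by
  induction n generalizing f g with
  | zero => exact Bas.add hf hg
  | succ n ih =>
    refine ⟨hf.1.add hg.1, hf.2.1.add hg.2.1, fun w => ?_⟩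
    rw [D_add hf.2.1 hg.2.1]
    exact ih (hf.2.2 w) (hg.2.2 w)

lemma BC.mul {O' : Set ℝ} (hf : BC O' n f) (hg : BC O n g) : BC O n (fun q => f q * g q) := by
  induction n generalizing f g with
  | zero => exact Bas.mul hf hg
  | succ n ih =>
    refine ⟨hf.1.mul hg.1, hf.2.1.mul hg.2.1, fun w => ?_⟩
    rw [D_mul hf.2.1 hg.2.1]
    exact (ih hf.down (hg.2.2 w)).add (ih (hf.2.2 w) hg.down)

lemma SB.add (hf : SB O f) (hg : SB O g) : SB O (fun q => f q + g q) :=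
  fun n => (hf n).add (hg n)

lemma SB.mul {O' : Set ℝ} (hf : SB O' f) (hg : SB O g) : SB O (fun q => f q * g q) :=
  fun n => (hf n).mul (hg n)

lemma SB.zero : SB O (fun _ => 0) := by
  intro n
  have hb : Bas O (fun _ => (0 : ℝ)) := ⟨continuous_const, ⟨0, by simp⟩, fun _ _ => rfl, fun _ _ => rfl⟩
  induction n with
  | zero => exact hb
  | succ n ih =>
    refine ⟨hb, differentiable_const _, fun w => ?_⟩
    rw [D_const]; exact ih

lemma SB.const (c : ℝ) : SB ∅ (fun _ => c) := by
  refine SB.mk' ⟨continuous_const, ⟨|c|, fun _ => le_rfl⟩, fun _ _ => rfl, by simp⟩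
    (differentiable_const _) fun w => ?_
  rw [D_const]
  exact SB.zero

lemma SB.mul' {O' : Set ℝ} (hf : SB O f) (hg : SB O' g) : SB O (fun q => f q * g q) := by
  have := hg.mul hf
  simpa only [mul_comm] using this

lemma SB.cmul (c : ℝ) (hf : SB O f) : SB O (fun q => c * f q) := (SB.const c).mul hf

lemma SB.mulc (hf : SB O f) (c : ℝ) : SB O (fun q => f q * c) := hf.mul' (SB.const c)

lemma SB.neg (hf : SB O f) : SB O (fun q => - f q) := by
  simpa using hf.cmul (-1)

lemma SB.sub (hf : SB O f) (hg : SB O g) : SB O (fun q => f q - g q) := by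
  simpa only [sub_eq_add_neg] using hf.add hg.neg

lemma SB.sum {ι : Type*} (s : Finset ι) {F : ι → STQ → ℝ} (h : ∀ i ∈ s, SB O (F i)) :
    SB O (fun q => ∑ i ∈ s, F i q) := by
  classical
  induction s using Finset.induction_on with
  | empty => simpa using SB.zero
  | insert a s ha ih =>
    simp only [Finset.sum_insert ha]
    exact (h a (by simp)).add (ih fun i hi => h i (by simp [hi]))

lemma Bas.mono {O' : Set ℝ} (hO : O' ⊆ O) (hf : Bas O f) : Bas O' f :=
  ⟨hf.cont, hf.bdd, hf.per, fun q hq => hf.van q (hO hq)⟩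

lemma SB.mono {O' : Set ℝ} (hO : O' ⊆ O) (hf : SB O f) : SB O' f := by
  intro n
  induction n generalizing f with
  | zero => exact hf.bas.mono hO
  | succ n ih => exact ⟨hf.bas.mono hO, hf.diff, fun w => ih (hf.D w)⟩

lemma SB.e (hf : SB O f) : SB ∅ f := hf.mono (empty_subset _)

lemma SB.of_van (hO : IsOpen O) (hf : SB ∅ f) (hv : ∀ q : STQ, q.1 ∈ O → f q = 0) : SB O f := by
  intro n
  induction n generalizing f with
  | zero => exact ⟨hf.cont, hf.bas.bdd, hf.bas.per, hv⟩
  | succ n ih =>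
    refine ⟨⟨hf.cont, hf.bas.bdd, hf.bas.per, hv⟩, hf.diff, fun w => ih (hf.D w) fun q hq => ?_⟩
    have : f =ᶠ[𝓝 q] fun _ => 0 := by
      have : ∀ᶠ q' : STQ in 𝓝 q, q'.1 ∈ O := (hO.preimage continuous_fst).mem_nhds hq
      filter_upwards [this] with q' hq' using hv q' hq'
    simp [CI.D, this.fderiv_eq]

/-- composition with a smooth function on an open set, range in a compact subset -/
lemma SB.comp_on {U K : Set ℝ} (hU : IsOpen U) (hK : IsCompact K) (hKU : K ⊆ U)
    {G : ℝ → ℝ} (hG : ContDiffOn ℝ (⊤ : ℕ∞) G U) (hf : SB ∅ f) (hfK : ∀ q, f q ∈ K) :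
    SB ∅ (fun q => G (f q)) := by
  intro n
  have hb : ∀ {G : ℝ → ℝ}, ContDiffOn ℝ (⊤ : ℕ∞) G U → Bas ∅ (fun q => G (f q)) := by
    intro G hG
    refine ⟨hG.continuousOn.comp_continuous hf.cont (fun q => hKU (hfK q)), ?_, ?_, by simp⟩
    · obtain ⟨C, hC⟩ := hK.exists_bound_of_continuousOn (hG.continuousOn.mono hKU)
      exact ⟨C, fun q => hC _ (hfK q)⟩
    · intro q k
      simp only [hf.bas.per q k]
  have hd : ∀ {G : ℝ → ℝ}, ContDiffOn ℝ (⊤ : ℕ∞) G U → ∀ x ∈ U, DifferentiableAt ℝ G x := by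
    intro G hG x hx
    exact (hG.differentiableOn (by simp)).differentiableAt (hU.mem_nhds hx)
  induction n generalizing G with
  | zero => exact hb hG
  | succ n ih =>
    refine ⟨hb hG, fun q => (hd hG _ (hKU (hfK q))).comp q (hf.diff q), fun w => ?_⟩
    have h1 : CI.D w (fun q => G (f q)) = fun q => deriv G (f q) * CI.D w f q := by
      funext q
      have := ((hd hG _ (hKU (hfK q))).hasDerivAt.comp_hasFDerivAt q (hf.diff q).hasFDerivAt)
      simp only [CI.D]
      have h2 := this.fderiv
      simp only [Function.comp_def] at h2
      rw [h2]; simp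
    rw [h1]
    exact (ih (hG.deriv_of_isOpen hU (by simp))).mul (hf.D w n)

lemma SB.comp {G : ℝ → ℝ} (hG : ContDiff ℝ (⊤ : ℕ∞) G) (hf : SB ∅ f) :
    SB ∅ (fun q => G (f q)) := by
  obtain ⟨C, hC⟩ := hf.bas.bdd
  exact SB.comp_on isOpen_univ (isCompact_Icc (a := -C) (b := C)) (subset_univ _)
    hG.contDiffOn hf (fun q => abs_le.1 (hC q))

lemma SB.comp_pos {G : ℝ → ℝ} (hG : ContDiffOn ℝ (⊤ : ℕ∞) G (Ioi 0)) (hf : SB ∅ f) {c : ℝ}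
    (hc : 0 < c) (hfc : ∀ q, c ≤ f q) :
    SB ∅ (fun q => G (f q)) := by
  obtain ⟨C, hC⟩ := hf.bas.bdd
  exact SB.comp_on isOpen_Ioi (isCompact_Icc (a := c) (b := C))
    (fun x hx => lt_of_lt_of_le hc hx.1) hG hf (fun q => ⟨hfc q, (abs_le.1 (hC q)).2⟩)

lemma SB.contDiff_nat (hf : SB O f) (n : ℕ) : ContDiff ℝ n f := by
  induction n generalizing f with
  | zero => exact_mod_cast (contDiff_zero (𝕜 := ℝ)).2 hf.cont
  | succ n ih =>
    push_cast
    rw [contDiff_succ_iff_fderiv_apply]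
    exact ⟨hf.diff, by simp, fun y => ih (hf.D y)⟩

lemma D_comm_of_contDiff (hf : ContDiff ℝ 2 f) (w w' : STQ) : D w (D w' f) = D w' (D w f) := by
  funext q
  have h1 : IsSymmSndFDerivAt ℝ f q := hf.contDiffAt.isSymmSndFDerivAt (by simp)
  have h2 : ∀ a b : STQ, D a (D b f) q = fderiv ℝ (fderiv ℝ f) q a b := by
    intro a b
    have h3 : DifferentiableAt ℝ (fderiv ℝ f) q :=
      (hf.fderiv_right (m := 1) (by norm_num)).differentiable (by norm_num) q
    have h4 : HasFDerivAt (fun q => fderiv ℝ f q b) _ q := h3.hasFDerivAt.clm_apply (hasFDerivAt_const b q)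
    have h5 := h4.fderiv
    change fderiv ℝ (fun q => fderiv ℝ f q b) q a = _
    rw [h5]
    simp
  rw [h2, h2]
  exact h1 w w'

lemma SB.D_comm (hf : SB O f) (w w' : STQ) : CI.D w (CI.D w' f) = CI.D w' (CI.D w f) :=
  D_comm_of_contDiff (hf.contDiff_nat 2) w w'

lemma vec_decomp (w : STQ) : w = w.1 • eT + ∑ j, w.2 j • eX j := by
  refine Prod.ext ?_ ?_
  · simp [eT, eX, Fin.sum_univ_three]
  · funext i
    simp only [eT, eX, Fin.sum_univ_three]
    fin_cases i <;> simp

lemma SB.uc (hf : SB O f) : UniformContinuous f := by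
  choose C hC using fun w => (hf.D w).bas.bdd
  have hC0 : ∀ w, 0 ≤ C w := fun w => (abs_nonneg _).trans (hC w 0)
  have hb : ∀ q, ‖fderiv ℝ f q‖ ≤ C eT + ∑ j, C (eX j) := by
    intro q
    refine ContinuousLinearMap.opNorm_le_bound _ (add_nonneg (hC0 _) (Finset.sum_nonneg fun j _ => hC0 _)) ?_
    intro w
    have h1 : fderiv ℝ f q w = w.1 * CI.D eT f q + ∑ j, w.2 j * CI.D (eX j) f q := by
      conv_lhs => rw [vec_decomp w]
      simp [CI.D]
    have hw1 : |w.1| ≤ ‖w‖ := norm_fst_le w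
    have hw2 : ∀ j, |w.2 j| ≤ ‖w‖ := fun j => (norm_le_pi_norm w.2 j).trans (norm_snd_le w)
    rw [h1, add_mul, Finset.sum_mul]
    refine (norm_add_le _ _).trans (add_le_add ?_ ((norm_sum_le _ _).trans (Finset.sum_le_sum fun j _ => ?_)))
    · rw [norm_mul, mul_comm]
      exact mul_le_mul (hC _ _) hw1 (norm_nonneg _) (hC0 _)
    · rw [norm_mul, mul_comm]
      exact mul_le_mul (hC _ _) (hw2 j) (norm_nonneg _) (hC0 _)
  have := lipschitzWith_of_nnnorm_fderiv_le (𝕜 := ℝ) hf.diff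
    (C := ⟨C eT + ∑ j, C (eX j), add_nonneg (hC0 _) (Finset.sum_nonneg fun j _ => hC0 _)⟩)
    (fun q => by exact_mod_cast hb q)
  exact this.uniformContinuous

end CI

namespace CI
open Set Filter Topology

variable {O : Set ℝ} {f g : STQ → ℝ} {n : ℕ}

/-- weighted average in direction `i` -/
def Kop (κ : ℝ → ℝ) (i : Fin 3) (f : STQ → ℝ) : STQ → ℝ :=
  fun q => ∫ y in (0 : ℝ)..1, κ y * f (q + y • eX i)

lemma Kop_bound {κ : ℝ → ℝ} (hκ1 : ∀ y ∈ Icc (0:ℝ) 1, |κ y| ≤ 1)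
    {C : ℝ} (hC : ∀ q, |f q| ≤ C) (i : Fin 3) (q : STQ) : |Kop κ i f q| ≤ C := by
  have h := intervalIntegral.norm_integral_le_of_norm_le_const (a := (0:ℝ)) (b := 1)
    (f := fun y => κ y * f (q + y • eX i)) (C := C) (fun y hy => by
      rw [uIoc_of_le zero_le_one] at hy
      rw [norm_mul]
      have h1 := hκ1 y ⟨hy.1.le, hy.2⟩
      have h2 := hC (q + y • eX i)
      calc ‖κ y‖ * ‖f (q + y • eX i)‖ ≤ 1 * C := mul_le_mul h1 h2 (norm_nonneg _) zero_le_one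
        _ = C := one_mul C)
  simpa [Kop] using h

lemma Bas.Kop {κ : ℝ → ℝ} (hκ : Continuous κ) (i : Fin 3) (hf : Bas O f) : Bas O (Kop κ i f) := by
  refine ⟨?_, ?_, ?_, ?_⟩
  · have := hf.cont
    unfold CI.Kop
    apply intervalIntegral.continuous_parametric_intervalIntegral_of_continuous'
    simp only [Function.uncurry_def]
    fun_prop
  · obtain ⟨C, hC⟩ := hf.bdd
    obtain ⟨B, hB⟩ := (isCompact_Icc (a := (0:ℝ)) (b := 1)).exists_bound_of_continuousOn hκ.continuousOn
    have hB0 : 0 ≤ B := (norm_nonneg _).trans (hB 0 (by simp))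
    refine ⟨B * C, fun q => ?_⟩
    have h := intervalIntegral.norm_integral_le_of_norm_le_const (a := (0:ℝ)) (b := 1)
      (f := fun y => κ y * f (q + y • eX i)) (C := B * C) (fun y hy => by
        rw [uIoc_of_le zero_le_one] at hy
        rw [norm_mul]
        exact mul_le_mul (hB y ⟨hy.1.le, hy.2⟩) (hC _) (norm_nonneg _) hB0)
    simpa [CI.Kop] using h
  · intro q k
    simp only [CI.Kop]
    congr 1
    funext y
    congr 1
    rw [← hf.per (q + y • eX i) k]
    congr 1
    refine Prod.ext rfl ?_
    funext j
    simp
    ring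
  · intro q hq
    simp only [CI.Kop]
    rw [intervalIntegral.integral_congr (g := fun _ => 0)]
    · simp
    · intro y _
      simp only
      rw [hf.van _ (by simpa [eX] using hq), mul_zero]

lemma fderiv_norm_bound (hf : SB O f) : ∃ C, ∀ q, ‖fderiv ℝ f q‖ ≤ C := by
  choose C hC using fun w => (hf.D w).bas.bdd
  have hC0 : ∀ w, 0 ≤ C w := fun w => (abs_nonneg _).trans (hC w 0)
  refine ⟨C eT + ∑ j, C (eX j), fun q => ?_⟩
  refine ContinuousLinearMap.opNorm_le_bound _ (add_nonneg (hC0 _) (Finset.sum_nonneg fun j _ => hC0 _)) ?_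
  intro w
  have h1 : fderiv ℝ f q w = w.1 * D eT f q + ∑ j, w.2 j * D (eX j) f q := by
    conv_lhs => rw [vec_decomp w]
    simp [D]
  have hw1 : |w.1| ≤ ‖w‖ := norm_fst_le w
  have hw2 : ∀ j, |w.2 j| ≤ ‖w‖ := fun j => (norm_le_pi_norm w.2 j).trans (norm_snd_le w)
  rw [h1, add_mul, Finset.sum_mul]
  refine (norm_add_le _ _).trans (add_le_add ?_ ((norm_sum_le _ _).trans (Finset.sum_le_sum fun j _ => ?_)))
  · rw [norm_mul, mul_comm]
    exact mul_le_mul (hC _ _) hw1 (norm_nonneg _) (hC0 _)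
  · rw [norm_mul, mul_comm]
    exact mul_le_mul (hC _ _) (hw2 j) (norm_nonneg _) (hC0 _)

lemma SB.fderiv_cont (hf : SB O f) : Continuous (fderiv ℝ f) :=
  (hf.contDiff_nat 1).continuous_fderiv (by simp)

lemma Kop_hasFDerivAt {κ : ℝ → ℝ} (hκ : Continuous κ) (i : Fin 3) (hf : SB O f) (q : STQ) :
    HasFDerivAt (Kop κ i f) (∫ y in (0 : ℝ)..1, κ y • fderiv ℝ f (q + y • eX i)) q := by
  obtain ⟨C, hC⟩ := fderiv_norm_bound hf
  have hfc := hf.cont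
  have hfd := hf.fderiv_cont
  apply intervalIntegral.hasFDerivAt_integral_of_dominated_of_fderiv_le (s := univ)
    (F := fun q y => κ y * f (q + y • eX i)) (F' := fun q y => κ y • fderiv ℝ f (q + y • eX i))
    (bound := fun y => |κ y| * C) univ_mem
  · refine Eventually.of_forall fun q => Continuous.aestronglyMeasurable (by fun_prop)
  · exact Continuous.intervalIntegrable (by fun_prop) _ _
  · exact Continuous.aestronglyMeasurable (by fun_prop)
  · refine Eventually.of_forall fun y _ q _ => ?_
    rw [norm_smul]
    exact mul_le_mul_of_nonneg_left (hC _) (abs_nonneg _)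
  · exact Continuous.intervalIntegrable (by fun_prop) _ _
  · refine Eventually.of_forall fun y _ q _ => ?_
    have h1 : HasFDerivAt (fun q : STQ => f (q + y • eX i)) (fderiv ℝ f (q + y • eX i)) q := by
      have h2 := (hf.diff (q + y • eX i)).hasFDerivAt.comp q ((hasFDerivAt_id q).add_const (y • eX i))
      simpa [Function.comp_def] using h2
    exact h1.const_mul (κ y)

lemma D_Kop {κ : ℝ → ℝ} (hκ : Continuous κ) (i : Fin 3) (hf : SB O f) (w : STQ) :
    D w (Kop κ i f) = Kop κ i (D w f) := by
  funext q
  simp only [D]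
  rw [(Kop_hasFDerivAt hκ i hf q).fderiv]
  have hfd := hf.fderiv_cont
  rw [ContinuousLinearMap.intervalIntegral_apply]
  · simp [Kop, D]
  · exact Continuous.intervalIntegrable (by fun_prop) _ _

lemma SB.Kop {κ : ℝ → ℝ} (hκ : Continuous κ) (i : Fin 3) (hf : SB O f) : SB O (Kop κ i f) := by
  intro n
  induction n generalizing f with
  | zero => exact hf.bas.Kop hκ i
  | succ n ih =>
    refine ⟨hf.bas.Kop hκ i, fun q => (Kop_hasFDerivAt hκ i hf q).differentiableAt, fun w => ?_⟩
    rw [D_Kop hκ i hf]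
    exact ih (hf.D w)

/-- mean in direction i -/
def mn (i : Fin 3) (f : STQ → ℝ) : STQ → ℝ := Kop (fun _ => 1) i f
/-- mean-free antiderivative in direction i -/
def Zn (i : Fin 3) (f : STQ → ℝ) : STQ → ℝ := Kop (fun y => y - 1/2) i f

lemma SB.mn (i : Fin 3) (hf : SB O f) : SB O (mn i f) := hf.Kop (by fun_prop) i
lemma SB.Zn (i : Fin 3) (hf : SB O f) : SB O (Zn i f) := hf.Kop (by fun_prop) i
lemma D_mn (i : Fin 3) (hf : SB O f) (w : STQ) : D w (mn i f) = mn i (D w f) :=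
  D_Kop (by fun_prop) i hf w
lemma D_Zn (i : Fin 3) (hf : SB O f) (w : STQ) : D w (Zn i f) = Zn i (D w f) :=
  D_Kop (by fun_prop) i hf w
lemma mn_bound {C : ℝ} (hC : ∀ q, |f q| ≤ C) (i : Fin 3) (q : STQ) : |mn i f q| ≤ C :=
  Kop_bound (by simp) hC i q
lemma Zn_bound {C : ℝ} (hC : ∀ q, |f q| ≤ C) (i : Fin 3) (q : STQ) : |Zn i f q| ≤ C :=
  Kop_bound (fun y hy => by rw [abs_le]; constructor <;> linarith [hy.1, hy.2]) hC i q

lemma hasDerivAt_line (hf : Differentiable ℝ f) (w q : STQ) (y : ℝ) :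
    HasDerivAt (fun y : ℝ => f (q + y • w)) (D w f (q + y • w)) y := by
  have h1 : HasDerivAt (fun y : ℝ => q + y • w) w y := by
    simpa using ((hasDerivAt_id y).smul_const w).const_add q
  exact (hf (q + y • w)).hasFDerivAt.comp_hasDerivAt y h1

lemma PerQ.shift (hf : PerQ f) (i : Fin 3) (q : STQ) : f (q + eX i) = f q := by
  rw [← hf q (Pi.single i 1)]
  congr 1
  refine Prod.ext ?_ ?_
  · simp [eX]
  · funext j
    by_cases h : j = i
    · subst h; simp [eX]
    · simp [eX, h]

lemma mn_D_self (i : Fin 3) (hf : SB O f) : mn i (D (eX i) f) = fun _ => 0 := by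
  funext q
  have hc := (hf.D (eX i)).cont
  simp only [mn, Kop, one_mul]
  rw [intervalIntegral.integral_eq_sub_of_hasDerivAt (f := fun y : ℝ => f (q + y • eX i))]
  · simp [hf.bas.per.shift i q]
  · intro y _
    exact hasDerivAt_line hf.diff _ _ _
  · exact Continuous.intervalIntegrable (by fun_prop) _ _

lemma D_Zn_self (i : Fin 3) (hf : SB O f) : D (eX i) (Zn i f) = fun q => f q - mn i f q := by
  rw [D_Zn i hf]
  funext q
  have hc := (hf.D (eX i)).cont
  have hfc := hf.cont
  simp only [mn, Zn, Kop, one_mul]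
  rw [intervalIntegral.integral_mul_deriv_eq_deriv_mul (u := fun y : ℝ => y - 1/2)
    (u' := fun _ => 1) (v := fun y : ℝ => f (q + y • eX i))
    (v' := fun y => D (eX i) f (q + y • eX i))]
  · simp [hf.bas.per.shift i q]
    ring
  · intro y _
    exact (hasDerivAt_id y).sub_const _
  · intro y _
    exact hasDerivAt_line hf.diff _ _ _
  · exact Continuous.intervalIntegrable (by fun_prop) _ _
  · exact Continuous.intervalIntegrable (by fun_prop) _ _

lemma mn_inv (i : Fin 3) (hf : SB O f) (q : STQ) (y : ℝ) : mn i f (q + y • eX i) = mn i f q := by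
  have hp : Function.Periodic (fun y : ℝ => f (q + y • eX i)) 1 := by
    intro y
    simp only [add_smul, one_smul, ← add_assoc]
    exact hf.bas.per.shift i _
  have h := hp.intervalIntegral_add_eq y 0
  simp only [mn, Kop, one_mul]
  have h2 : ∫ z in (0:ℝ)..1, f (q + y • eX i + z • eX i) = ∫ z in (y)..(y+1), f (q + z • eX i) := by
    have := intervalIntegral.integral_comp_add_left (a := (0:ℝ)) (b := 1) (fun z => f (q + z • eX i)) y
    simp only [add_zero] at this
    rw [← this]
    simp only [add_smul, add_assoc]
  rw [h2, h]
  simp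

lemma mn_Zn (i : Fin 3) (hf : SB O f) : mn i (Zn i f) = fun _ => 0 := by
  funext q
  have hc := hf.cont
  have hsw : ∫ x in (0:ℝ)..1, (∫ y in (0:ℝ)..1, (y - 1/2) * f (q + x • eX i + y • eX i)) =
      ∫ y in (0:ℝ)..1, (∫ x in (0:ℝ)..1, (y - 1/2) * f (q + x • eX i + y • eX i)) := by
    simp only [intervalIntegral.integral_of_le zero_le_one]
    apply integral_integral_swap
    rw [Measure.prod_restrict]
    have : IntegrableOn (Function.uncurry fun x y : ℝ => (y - 1/2) * f (q + x • eX i + y • eX i))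
        (Icc (0:ℝ) 1 ×ˢ Icc (0:ℝ) 1) (volume.prod volume) := by
      apply ContinuousOn.integrableOn_compact (isCompact_Icc.prod isCompact_Icc)
      simp only [Function.uncurry_def]
      fun_prop
    exact this.mono_set (prod_mono Ioc_subset_Icc_self Ioc_subset_Icc_self)
  simp only [mn, Zn, Kop, one_mul]
  rw [hsw]
  · have : ∀ y : ℝ, (∫ x in (0:ℝ)..1, (y - 1/2) * f (q + x • eX i + y • eX i))
        = (y - 1/2) * mn i f q := by
      intro y
      rw [intervalIntegral.integral_const_mul, ← mn_inv i hf q y]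
      simp only [mn, Kop, one_mul]
      congr 2
      funext x
      rw [add_right_comm]
    simp only [this]
    rw [intervalIntegral.integral_mul_const]
    rw [intervalIntegral.integral_sub (by simp) (by simp)]
    simp [integral_id]

lemma mn_add (i : Fin 3) (hf : Continuous f) (hg : Continuous g) :
    mn i (fun q => f q + g q) = fun q => mn i f q + mn i g q := by
  funext q
  simp only [mn, Kop, one_mul]
  rw [intervalIntegral.integral_add]
  · exact Continuous.intervalIntegrable (by fun_prop) _ _
  · exact Continuous.intervalIntegrable (by fun_prop) _ _

lemma mn_zero (i : Fin 3) : mn i (fun _ => 0) = fun _ => 0 := by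
  funext q
  simp [mn, Kop]

/-- total mean -/
def Mn (f : STQ → ℝ) : STQ → ℝ := mn 2 (mn 1 (mn 0 f))

lemma SB.Mn (hf : SB O f) : SB O (Mn f) := ((hf.mn 0).mn 1).mn 2

lemma Mn_zero : Mn (fun _ => 0) = fun _ => 0 := by simp [Mn, mn_zero]

lemma Mn_add (hf : SB O f) (hg : SB O g) : Mn (fun q => f q + g q) = fun q => Mn f q + Mn g q := by
  unfold Mn
  rw [mn_add 0 hf.cont hg.cont, mn_add 1 (hf.mn 0).cont (hg.mn 0).cont,
    mn_add 2 ((hf.mn 0).mn 1).cont ((hg.mn 0).mn 1).cont]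

lemma Mn_D (hf : SB O f) (w : STQ) : D w (Mn f) = Mn (D w f) := by
  unfold Mn
  rw [D_mn 2 ((hf.mn 0).mn 1), D_mn 1 (hf.mn 0), D_mn 0 hf]

lemma Mn_DX (hf : SB O f) (j : Fin 3) : Mn (D (eX j) f) = fun _ => 0 := by
  unfold Mn
  fin_cases j
  · simp only [Fin.zero_eta, Fin.isValue]
    rw [mn_D_self 0 hf, mn_zero, mn_zero]
  · simp only [Fin.mk_one, Fin.isValue]
    rw [← D_mn 0 hf, mn_D_self 1 (hf.mn 0), mn_zero]
  · simp only [Fin.reduceFinMk, Fin.isValue]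
    rw [← D_mn 0 hf, ← D_mn 1 (hf.mn 0), mn_D_self 2 ((hf.mn 0).mn 1)]

lemma Mn_sum {ι : Type*} (s : Finset ι) {F : ι → STQ → ℝ} (h : ∀ i ∈ s, SB O (F i)) :
    Mn (fun q => ∑ i ∈ s, F i q) = fun q => ∑ i ∈ s, Mn (F i) q := by
  classical
  induction s using Finset.induction_on with
  | empty => simpa using Mn_zero
  | insert a s ha ih =>
    simp only [Finset.sum_insert ha]
    rw [Mn_add (h a (by simp)) (SB.sum s fun i hi => h i (by simp [hi])),
      ih fun i hi => h i (by simp [hi])]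

end CI

namespace CI
open Set Filter Topology

variable {O : Set ℝ} {f g : STQ → ℝ} {n : ℕ}

def dl (a b : Fin 3) : ℝ := if a = b then 1 else 0

lemma dl_self (a : Fin 3) : dl a a = 1 := by simp [dl]
lemma dl_comm (a b : Fin 3) : dl a b = dl b a := by simp [dl, eq_comm]
lemma dl_abs (a b : Fin 3) : |dl a b| ≤ 1 := by unfold dl; split_ifs <;> simp
lemma sum_dl (i : Fin 3) (F : Fin 3 → ℝ) : ∑ j, dl j i * F j = F i := by simp [dl]

/-- column divergence of a tensor -/
def dv (S : Fin 3 → Fin 3 → STQ → ℝ) (k : Fin 3) : STQ → ℝ := fun q => ∑ j, D (eX j) (S j k) q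

structure ST (O : Set ℝ) (S : Fin 3 → Fin 3 → STQ → ℝ) : Prop where
  sb : ∀ j k, SB O (S j k)
  symm : ∀ j k q, S j k q = S k j q

lemma SB.D_cmul (hf : SB O f) (c : ℝ) (w : STQ) : CI.D w (fun q => c * f q) = fun q => c * CI.D w f q := by
  rw [D_mul (differentiable_const c) hf.diff, D_const]
  simp

lemma SB.D_mul {O' : Set ℝ} (hf : SB O f) (hg : SB O' g) (w : STQ) :
    CI.D w (fun q => f q * g q) = fun q => f q * CI.D w g q + CI.D w f q * g q :=
  CI.D_mul hf.diff hg.diff w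

lemma SB.D_add {O' : Set ℝ} (hf : SB O f) (hg : SB O' g) (w : STQ) :
    CI.D w (fun q => f q + g q) = fun q => CI.D w f q + CI.D w g q :=
  CI.D_add hf.diff hg.diff w

lemma SB.D_sub {O' : Set ℝ} (hf : SB O f) (hg : SB O' g) (w : STQ) :
    CI.D w (fun q => f q - g q) = fun q => CI.D w f q - CI.D w g q := by
  have := hf.D_add (hg.cmul (-1)) w
  rw [hg.D_cmul] at this
  simp only [neg_mul, one_mul, ← sub_eq_add_neg] at this
  exact this

lemma SB.D_sum {ι : Type*} (s : Finset ι) {F : ι → STQ → ℝ} (h : ∀ i ∈ s, SB O (F i)) (w : STQ) :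
    CI.D w (fun q => ∑ i ∈ s, F i q) = fun q => ∑ i ∈ s, CI.D w (F i) q := by
  classical
  induction s using Finset.induction_on with
  | empty => simpa using D_const 0 w
  | insert a s ha ih =>
    simp only [Finset.sum_insert ha]
    rw [(h a (by simp)).D_add (SB.sum s fun i hi => h i (by simp [hi])),
      ih fun i hi => h i (by simp [hi])]

lemma dv_sb {S : Fin 3 → Fin 3 → STQ → ℝ} (h : ∀ j k, SB O (S j k)) (k : Fin 3) : SB O (dv S k) :=
  SB.sum _ fun j _ => (h j k).D _

lemma Mn_dv {S : Fin 3 → Fin 3 → STQ → ℝ} (h : ∀ j k, SB O (S j k)) (k : Fin 3) :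
    Mn (dv S k) = fun _ => 0 := by
  unfold dv
  rw [Mn_sum _ fun j _ => (h j k).D _]
  funext q
  simp [Mn_DX (h _ k)]

lemma dv_add {S T : Fin 3 → Fin 3 → STQ → ℝ} (h : ∀ j k, SB O (S j k)) (h' : ∀ j k, SB O (T j k))
    (k : Fin 3) (q : STQ) : dv (fun j k q => S j k q + T j k q) k q = dv S k q + dv T k q := by
  unfold dv
  rw [← Finset.sum_add_distrib]
  refine Finset.sum_congr rfl fun j _ => ?_
  rw [(h j k).D_add (h' j k)]

lemma dv_cmul {S : Fin 3 → Fin 3 → STQ → ℝ} (h : ∀ j k, SB O (S j k)) (c : ℝ)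
    (k : Fin 3) (q : STQ) : dv (fun j k q => c * S j k q) k q = c * dv S k q := by
  unfold dv
  rw [Finset.mul_sum]
  refine Finset.sum_congr rfl fun j _ => ?_
  rw [(h j k).D_cmul]

lemma dv_sum {ι : Type*} (s : Finset ι) {F : ι → Fin 3 → Fin 3 → STQ → ℝ}
    (h : ∀ i, ∀ j k, SB O (F i j k)) (k : Fin 3) (q : STQ) :
    dv (fun j k q => ∑ i ∈ s, F i j k q) k q = ∑ i ∈ s, dv (F i) k q := by
  unfold dv
  rw [Finset.sum_comm]
  refine Finset.sum_congr rfl fun j _ => ?_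
  rw [SB.D_sum s fun i _ => h i j k]

lemma ST.add {S T : Fin 3 → Fin 3 → STQ → ℝ} (h : ST O S) (h' : ST O T) :
    ST O (fun j k q => S j k q + T j k q) :=
  ⟨fun j k => (h.sb j k).add (h'.sb j k), fun j k q => by rw [h.symm, h'.symm]⟩

lemma ST.cmul {S : Fin 3 → Fin 3 → STQ → ℝ} (h : ST O S) (c : ℝ) :
    ST O (fun j k q => c * S j k q) :=
  ⟨fun j k => (h.sb j k).cmul c, fun j k q => by rw [h.symm]⟩

lemma ST.sum {ι : Type*} (s : Finset ι) {F : ι → Fin 3 → Fin 3 → STQ → ℝ} (h : ∀ i, ST O (F i)) :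
    ST O (fun j k q => ∑ i ∈ s, F i j k q) :=
  ⟨fun j k => SB.sum s fun i _ => (h i).sb j k,
    fun j k q => Finset.sum_congr rfl fun i _ => (h i).symm j k q⟩

/-- elementary anti-divergence -/
def adS (i l : Fin 3) (a : STQ → ℝ) : Fin 3 → Fin 3 → STQ → ℝ := fun j k q =>
  (dl j i * dl k l + dl j l * dl k i) * Zn i a q +
    (-(dl j i * dl k i)) * Zn i (D (eX l) (Zn i a)) q

lemma adS_ST (i l : Fin 3) {a : STQ → ℝ} (ha : SB O a) : ST O (adS i l a) := by
  refine ⟨fun j k => ((ha.Zn i).cmul _).add ((((ha.Zn i).D _).Zn i).cmul _), fun j k q => ?_⟩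
  unfold adS
  ring

lemma adS_dv (i l : Fin 3) {a : STQ → ℝ} (ha : SB O a) (k : Fin 3) (q : STQ) :
    dv (adS i l a) k q = dl k l * (a q - mn i a q) := by
  have h1 := ha.Zn i
  have h2 := (h1.D (eX l)).Zn i
  have h3 : ∀ j, D (eX j) (adS i l a j k) q = (dl j i * dl k l + dl j l * dl k i) * D (eX j) (Zn i a) q +
    (-(dl j i * dl k i)) * D (eX j) (Zn i (D (eX l) (Zn i a))) q := by
    intro j
    unfold adS
    rw [(h1.cmul _).D_add (h2.cmul _), h1.D_cmul, h2.D_cmul]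
  have h4 : D (eX i) (Zn i (D (eX l) (Zn i a))) q = D (eX l) (Zn i a) q := by
    rw [D_Zn_self i (h1.D (eX l)), ← D_mn i h1, mn_Zn i ha, D_const]
    simp
  have h5 := congrFun (D_Zn_self i ha) q
  unfold dv
  simp only [h3]
  have h6 : ∀ j, (dl j i * dl k l + dl j l * dl k i) * D (eX j) (Zn i a) q +
    (-(dl j i * dl k i)) * D (eX j) (Zn i (D (eX l) (Zn i a))) q =
      dl j i * (dl k l * D (eX j) (Zn i a) q) + dl j l * (dl k i * D (eX j) (Zn i a) q) +
      dl j i * (- dl k i * D (eX j) (Zn i (D (eX l) (Zn i a))) q) := by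
    intro j; ring
  simp only [h6, Finset.sum_add_distrib, sum_dl, h4, h5]
  ring

lemma adS_bound (i l : Fin 3) {a : STQ → ℝ} (ha : SB O a) {C : ℝ} (h1 : ∀ q, |a q| ≤ C)
    (h2 : ∀ q, |D (eX l) a q| ≤ C) (j k : Fin 3) (q : STQ) : |adS i l a j k q| ≤ 3 * C := by
  have hC : 0 ≤ C := (abs_nonneg _).trans (h1 0)
  have b1 := Zn_bound h1 i q
  have b2 : |Zn i (D (eX l) (Zn i a)) q| ≤ C := by
    rw [D_Zn i ha]
    exact Zn_bound (fun q => Zn_bound h2 i q) i q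
  unfold adS
  have c1 : |dl j i * dl k l + dl j l * dl k i| ≤ 2 := by
    unfold dl; split_ifs <;> norm_num
  have c2 : |-(dl j i * dl k i)| ≤ 1 := by
    unfold dl; split_ifs <;> norm_num
  refine (abs_add_le _ _).trans ?_
  rw [abs_mul, abs_mul]
  have := mul_le_mul c1 b1 (abs_nonneg _) (by norm_num)
  have := mul_le_mul c2 b2 (abs_nonneg _) (by norm_num)
  linarith

/-- partial means -/
def pm (i : Fin 3) (f : STQ → ℝ) : STQ → ℝ := ![f, mn 0 f, mn 1 (mn 0 f)] i

lemma SB.pm (i : Fin 3) (hf : SB O f) : SB O (pm i f) := by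
  fin_cases i
  · exact hf
  · exact hf.mn 0
  · exact (hf.mn 0).mn 1

lemma pm_bound (i : Fin 3) {C : ℝ} (h : ∀ q, |f q| ≤ C) (q : STQ) : |pm i f q| ≤ C := by
  fin_cases i
  · exact h q
  · exact mn_bound h 0 q
  · exact mn_bound (fun q => mn_bound h 0 q) 1 q

lemma D_pm (i : Fin 3) (hf : SB O f) (w : STQ) : D w (pm i f) = pm i (D w f) := by
  fin_cases i
  · rfl
  · exact D_mn 0 hf w
  · change D w (mn 1 (mn 0 f)) = mn 1 (mn 0 (D w f))
    rw [D_mn 1 (hf.mn 0), D_mn 0 hf]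

lemma pm_sum (q : STQ) : ∑ i, (pm i f q - mn i (pm i f) q) = f q - Mn f q := by
  simp [Fin.sum_univ_three, pm, Mn]
  ring

def Rop (g : Fin 3 → STQ → ℝ) : Fin 3 → Fin 3 → STQ → ℝ := fun j k q =>
  ∑ l, ∑ i, adS i l (pm i (g l)) j k q

lemma Rop_ST {g : Fin 3 → STQ → ℝ} (hg : ∀ l, SB O (g l)) : ST O (Rop g) :=
  ST.sum _ fun l => ST.sum _ fun i => adS_ST i l ((hg l).pm i)

lemma Rop_dv {g : Fin 3 → STQ → ℝ} (hg : ∀ l, SB O (g l)) (k : Fin 3) (q : STQ) :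
    dv (Rop g) k q = g k q - Mn (g k) q := by
  unfold Rop
  rw [dv_sum (F := fun l j k q => ∑ i, adS i l (pm i (g l)) j k q) _
    (fun l => (ST.sum _ fun i => adS_ST i l ((hg l).pm i)).sb)]
  have : ∀ l, dv (fun j k q => ∑ i, adS i l (pm i (g l)) j k q) k q =
      dl l k * (g l q - Mn (g l) q) := by
    intro l
    rw [dv_sum (F := fun i => adS i l (pm i (g l))) _ (fun i => (adS_ST i l ((hg l).pm i)).sb)]
    simp only [adS_dv _ _ ((hg l).pm _)]
    rw [← Finset.mul_sum, pm_sum, dl_comm]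
  simp only [this, sum_dl]

lemma Rop_bound {g : Fin 3 → STQ → ℝ} (hg : ∀ l, SB O (g l)) {C : ℝ} (h1 : ∀ l q, |g l q| ≤ C)
    (h2 : ∀ l j q, |D (eX j) (g l) q| ≤ C) (j k : Fin 3) (q : STQ) : |Rop g j k q| ≤ 27 * C := by
  unfold Rop
  have : ∀ l i, |adS i l (pm i (g l)) j k q| ≤ 3 * C := by
    intro l i
    refine adS_bound i l ((hg l).pm i) (fun q => pm_bound i (h1 l) q) (fun q => ?_) j k q
    rw [D_pm i (hg l)]
    exact pm_bound i (h2 l l) q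
  calc |∑ l, ∑ i, adS i l (pm i (g l)) j k q| ≤ ∑ l : Fin 3, ∑ i : Fin 3, 3 * C :=
        (Finset.abs_sum_le_sum_abs _ _).trans (Finset.sum_le_sum fun l _ =>
          (Finset.abs_sum_le_sum_abs _ _).trans (Finset.sum_le_sum fun i _ => this l i))
    _ = 27 * C := by simp; ring

/-! oscillating functions -/

def Lam (n : ℕ) : ℝ := 2 * Real.pi * n

def cs (n : ℕ) (m : Fin 3) (s φ : ℝ) : STQ → ℝ := fun q => Real.cos (Lam n * (q.2 m - s * q.1) + φ)

lemma cs_abs (n : ℕ) (m : Fin 3) (s φ : ℝ) (q : STQ) : |cs n m s φ q| ≤ 1 := Real.abs_cos_le_one _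

lemma cs_hasFDerivAt (n : ℕ) (m : Fin 3) (s φ : ℝ) (q : STQ) :
    DifferentiableAt ℝ (cs n m s φ) q ∧
    ∀ w, D w (cs n m s φ) q = Lam n * (w.2 m - s * w.1) * cs n m s (φ + Real.pi / 2) q := by
  have h0 : HasFDerivAt (fun q : STQ => q.2 m)
      ((ContinuousLinearMap.proj (R := ℝ) (φ := fun _ : Fin 3 => ℝ) m).comp (ContinuousLinearMap.snd ℝ ℝ Spc)) q :=
    ((ContinuousLinearMap.proj (R := ℝ) (φ := fun _ : Fin 3 => ℝ) m).comp
      (ContinuousLinearMap.snd ℝ ℝ Spc)).hasFDerivAt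
  have h1 : HasFDerivAt (fun q : STQ => q.1) (ContinuousLinearMap.fst ℝ ℝ Spc) q :=
    (ContinuousLinearMap.fst ℝ ℝ Spc).hasFDerivAt
  have h2 := (((h0.sub (h1.const_mul s)).const_mul (Lam n)).add_const φ).cos
  refine ⟨h2.differentiableAt, fun w => ?_⟩
  have h3 : fderiv ℝ (cs n m s φ) q = _ := h2.fderiv
  simp only [D, h3, cs]
  have : Real.cos (Lam n * (q.2 m - s * q.1) + (φ + Real.pi / 2)) =
    - Real.sin (Lam n * (q.2 m - s * q.1) + φ) := by
    rw [← add_assoc, Real.cos_add_pi_div_two]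
  rw [this]
  simp
  ring

lemma cs_D (n : ℕ) (m : Fin 3) (s φ : ℝ) (w : STQ) :
    D w (cs n m s φ) = fun q => Lam n * (w.2 m - s * w.1) * cs n m s (φ + Real.pi / 2) q :=
  funext fun q => (cs_hasFDerivAt n m s φ q).2 w

lemma cs_DX (n : ℕ) (m : Fin 3) (s φ : ℝ) (j : Fin 3) :
    D (eX j) (cs n m s φ) = fun q => Lam n * dl j m * cs n m s (φ + Real.pi / 2) q := by
  rw [cs_D]
  funext q
  simp only [eX, dl]
  by_cases h : j = m
  · subst h; simp
  · have : m ≠ j := fun h' => h h'.symm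
    simp [h, this]

lemma cs_DT (n : ℕ) (m : Fin 3) (s φ : ℝ) :
    D eT (cs n m s φ) = fun q => - (Lam n * s) * cs n m s (φ + Real.pi / 2) q := by
  rw [cs_D]
  funext q
  simp [eT]

lemma cs_bas (n : ℕ) (m : Fin 3) (s φ : ℝ) : Bas ∅ (cs n m s φ) := by
  refine ⟨continuous_iff_continuousAt.2 fun q => (cs_hasFDerivAt n m s φ q).1.continuousAt,
    ⟨1, cs_abs n m s φ⟩, fun q k => ?_, by simp⟩
  simp only [cs, Lam]
  rw [show 2 * Real.pi * n * (q.2 m + (k m : ℝ) - s * q.1) + φ =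
    2 * Real.pi * n * (q.2 m - s * q.1) + φ + ((n * k m : ℤ) : ℝ) * (2 * Real.pi) by push_cast; ring]
  exact Real.cos_add_int_mul_two_pi _ _

lemma cs_SB (n : ℕ) (m : Fin 3) (s φ : ℝ) : SB ∅ (cs n m s φ) := by
  intro N
  induction N generalizing φ with
  | zero => exact cs_bas n m s φ
  | succ N ih =>
    refine ⟨cs_bas n m s φ, fun q => (cs_hasFDerivAt n m s φ q).1, fun w => ?_⟩
    rw [cs_D]
    exact (SB.const _ N).mul (ih _)

lemma Lam_pos {n : ℕ} (hn : 1 ≤ n) : (n : ℝ) ≤ Lam n ∧ 1 ≤ Lam n := by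
  have h1 : (1 : ℝ) ≤ n := by exact_mod_cast hn
  have : 1 ≤ 2 * Real.pi := by linarith [Real.pi_gt_three]
  have : (n : ℝ) ≤ Lam n := by unfold Lam; nlinarith
  exact ⟨this, h1.trans this⟩

/-- symmetric symbol -/
def Msym (m : Fin 3) (h : Fin 3 → STQ → ℝ) : Fin 3 → Fin 3 → STQ → ℝ := fun j k q =>
  dl k m * h j q + dl j m * h k q + (- (dl j m * dl k m)) * h m q

lemma Msym_ST (m : Fin 3) {h : Fin 3 → STQ → ℝ} (hh : ∀ l, SB O (h l)) : ST O (Msym m h) := by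
  refine ⟨fun j k => (((hh j).cmul _).add ((hh k).cmul _)).add ((hh m).cmul _), fun j k q => ?_⟩
  unfold Msym; ring

lemma ST_bdd {S : Fin 3 → Fin 3 → STQ → ℝ} (h : ∀ j k, SB O (S j k)) :
    ∃ C, 0 ≤ C ∧ ∀ j k q, |S j k q| ≤ C := by
  choose C hC using fun j k => (h j k).bas.bdd
  have h0 : ∀ j k, 0 ≤ C j k := fun j k => (abs_nonneg _).trans (hC j k 0)
  refine ⟨∑ j, ∑ k, C j k, Finset.sum_nonneg fun j _ => Finset.sum_nonneg fun k _ => h0 j k,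
    fun j k q => (hC j k q).trans ?_⟩
  calc C j k ≤ ∑ k, C j k := Finset.single_le_sum (fun k _ => h0 j k) (Finset.mem_univ k)
    _ ≤ _ := Finset.single_le_sum (f := fun j => ∑ k, C j k)
      (fun j _ => Finset.sum_nonneg fun k _ => h0 j k) (Finset.mem_univ j)

lemma vec_bdd {h : Fin 3 → STQ → ℝ} (hh : ∀ j, SB O (h j)) :
    ∃ C, 0 ≤ C ∧ ∀ j q, |h j q| ≤ C := by
  obtain ⟨C, h0, hC⟩ := ST_bdd (S := fun j _ => h j) (fun j _ => hh j)
  exact ⟨C, h0, fun j q => hC j 0 q⟩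

lemma par_step (m : Fin 3) (s : ℝ) {h : Fin 3 → STQ → ℝ} (hh : ∀ l, SB O (h l)) {n : ℕ} (hn : 1 ≤ n)
    (φ : ℝ) (k : Fin 3) (q : STQ) :
    h k q * cs n m s φ q =
      dv (fun j k q => (1 / Lam n * cs n m s (φ - Real.pi / 2) q) * Msym m h j k q) k q +
      (1 / Lam n) * (- dv (Msym m h) k q * cs n m s (φ - Real.pi / 2) q) := by
  have hL : Lam n ≠ 0 := by linarith [(Lam_pos hn).2]
  have hM := Msym_ST m hh
  have hc := (cs_SB n m s (φ - Real.pi / 2))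
  have hD : ∀ j, D (eX j) (fun q => (1 / Lam n * cs n m s (φ - Real.pi / 2) q) * Msym m h j k q) q =
      1 / Lam n * cs n m s (φ - Real.pi / 2) q * D (eX j) (Msym m h j k) q +
      dl j m * (cs n m s φ q * Msym m h j k q) := by
    intro j
    rw [(hc.cmul _).D_mul (hM.sb j k), hc.D_cmul, cs_DX]
    simp only [sub_add_cancel]
    field_simp
  unfold dv
  simp only [hD, Finset.sum_add_distrib, sum_dl, ← Finset.mul_sum]
  have : Msym m h m k q = h k q := by simp only [Msym, dl_self]; ring
  rw [this]
  ring

lemma osc (m : Fin 3) (s : ℝ) {h : Fin 3 → STQ → ℝ} (hh : ∀ l, SB O (h l)) :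
    ∃ C, 0 ≤ C ∧ ∀ n : ℕ, 1 ≤ n → ∀ φ : ℝ, ∃ S, ST O S ∧ (∀ j k q, |S j k q| ≤ C / n) ∧
      ∀ k q, dv S k q = h k q * cs n m s φ q - Mn (fun q => h k q * cs n m s φ q) q := by
  set h1 : Fin 3 → STQ → ℝ := fun k q => - dv (Msym m h) k q with hh1
  have sh1 : ∀ l, SB O (h1 l) := fun l => (dv_sb (Msym_ST m hh).sb l).neg
  set h2 : Fin 3 → STQ → ℝ := fun k q => - dv (Msym m h1) k q with hh2
  have sh2 : ∀ l, SB O (h2 l) := fun l => (dv_sb (Msym_ST m sh1).sb l).neg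
  obtain ⟨C0, p0, b0⟩ := ST_bdd (Msym_ST m hh).sb
  obtain ⟨C1, p1, b1⟩ := ST_bdd (Msym_ST m sh1).sb
  obtain ⟨C2, p2, b2⟩ := vec_bdd sh2
  obtain ⟨C3, p3, b3⟩ := ST_bdd (S := fun j l => D (eX j) (h2 l)) (fun j l => (sh2 l).D _)
  refine ⟨C0 + C1 + 27 * (C2 + C3), by positivity, fun n hn φ => ?_⟩
  obtain ⟨hL1, hL⟩ := Lam_pos hn
  have hLp : 0 < Lam n := by linarith
  have hn0 : (0:ℝ) < n := by exact_mod_cast hn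
  set r : Fin 3 → STQ → ℝ := fun k q => (1 / Lam n * (1 / Lam n)) * (h2 k q * cs n m s (φ - Real.pi / 2 - Real.pi / 2) q) with hr
  have sr0 : ∀ k, SB O (fun q => h2 k q * cs n m s (φ - Real.pi / 2 - Real.pi / 2) q) :=
    fun k => (sh2 k).mul' (cs_SB _ _ _ _)
  have sr : ∀ k, SB O (r k) := fun k => (sr0 k).cmul _
  set S1 : Fin 3 → Fin 3 → STQ → ℝ := fun j k q => (1 / Lam n * cs n m s (φ - Real.pi / 2) q) * Msym m h j k q with hS1
  set S2 : Fin 3 → Fin 3 → STQ → ℝ := fun j k q => (1 / Lam n * cs n m s (φ - Real.pi / 2 - Real.pi / 2) q) * Msym m h1 j k q with hS2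
  have sS1 : ST O S1 := ⟨fun j k => ((cs_SB _ _ _ _).cmul _).mul ((Msym_ST m hh).sb j k),
    fun j k q => by simp only [hS1, (Msym_ST m hh).symm j k q]⟩
  have sS2 : ST O S2 := ⟨fun j k => ((cs_SB _ _ _ _).cmul _).mul ((Msym_ST m sh1).sb j k),
    fun j k q => by simp only [hS2, (Msym_ST m sh1).symm j k q]⟩
  have key : ∀ k q, h k q * cs n m s φ q = dv S1 k q + (1 / Lam n) * dv S2 k q + r k q := by
    intro k q
    rw [par_step m s hh hn φ k q]
    have := par_step m s sh1 hn (φ - Real.pi / 2) k q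
    simp only [hh1] at this
    rw [this]
    simp only [hr, hh2]
    ring
  have invL : 1 / Lam n ≤ 1 / n := one_div_le_one_div_of_le hn0 hL1
  have invL1 : 1 / Lam n ≤ 1 := by rw [div_le_one hLp]; exact hL
  have invL0 : 0 ≤ 1 / Lam n := by positivity
  refine ⟨fun j k q => (S1 j k q + (1 / Lam n) * S2 j k q) + Rop r j k q,
    (sS1.add (sS2.cmul _)).add (Rop_ST sr), fun j k q => ?_, fun k q => ?_⟩
  · have e1 : |S1 j k q| ≤ C0 * (1 / n) := by
      simp only [hS1]
      rw [abs_mul, abs_mul, abs_of_nonneg invL0]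
      calc 1 / Lam n * |cs n m s (φ - Real.pi / 2) q| * |Msym m h j k q| ≤ (1 / n * 1) * C0 := by
            have := cs_abs n m s (φ - Real.pi / 2) q
            have := b0 j k q
            gcongr
        _ = _ := by ring
    have e2 : |1 / Lam n * S2 j k q| ≤ C1 * (1 / n) := by
      simp only [hS2]
      rw [abs_mul, abs_mul, abs_mul, abs_of_nonneg invL0]
      calc 1 / Lam n * (1 / Lam n * |cs n m s (φ - Real.pi / 2 - Real.pi / 2) q| * |Msym m h1 j k q|)
          ≤ 1 / n * ((1 * 1) * C1) := by
            have := cs_abs n m s (φ - Real.pi / 2 - Real.pi / 2) q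
            have := b1 j k q
            gcongr
        _ = _ := by ring
    have e3 : |Rop r j k q| ≤ 27 * ((C2 + C3) * (1 / n)) := by
      refine Rop_bound sr (fun l q => ?_) (fun l j q => ?_) j k q
      · simp only [hr]
        rw [abs_mul, abs_mul, abs_mul, abs_of_nonneg invL0]
        have e : 1 / Lam n * (1 / Lam n) * (|h2 l q| * |cs n m s (φ - Real.pi / 2 - Real.pi / 2) q|)
          ≤ 1 / n * 1 * (C2 * 1) := by
          have := cs_abs n m s (φ - Real.pi / 2 - Real.pi / 2) q
          have := b2 l q
          gcongr
        have : 0 ≤ C3 * (1 / (n:ℝ)) := by positivity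
        linarith
      · simp only [hr]
        rw [(sr0 l).D_cmul, (sh2 l).D_mul (cs_SB _ _ _ _), cs_DX]
        simp only
        set x := cs n m s (φ - Real.pi / 2 - Real.pi / 2 + Real.pi / 2) q
        have hx : |x| ≤ 1 := cs_abs _ _ _ _ _
        set y := cs n m s (φ - Real.pi / 2 - Real.pi / 2) q
        have hy : |y| ≤ 1 := cs_abs _ _ _ _ _
        have e : 1 / Lam n * (1 / Lam n) * (h2 l q * (Lam n * dl j m * x) + D (eX j) (h2 l) q * y)
            = 1 / Lam n * (h2 l q * (dl j m * x)) + (1 / Lam n) * ((1 / Lam n) * (D (eX j) (h2 l) q * y)) := by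
          field_simp
        rw [e]
        refine (abs_add_le _ _).trans ?_
        rw [add_mul]
        simp only [abs_mul]
        rw [abs_of_nonneg invL0]
        have d := dl_abs j m
        have := b2 l q
        have := b3 j l q
        apply add_le_add
        · calc 1 / Lam n * (|h2 l q| * (|dl j m| * |x|)) ≤ 1 / n * (C2 * (1 * 1)) := by gcongr
            _ = _ := by ring
        · calc 1 / Lam n * (1 / Lam n * (|D (eX j) (h2 l) q| * |y|)) ≤ 1 / n * (1 * (C3 * 1)) := by gcongr
            _ = _ := by ring
    have := abs_add_le (S1 j k q + (1 / Lam n) * S2 j k q) (Rop r j k q)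
    have := abs_add_le (S1 j k q) ((1 / Lam n) * S2 j k q)
    calc _ ≤ C0 * (1/n) + C1 * (1/n) + 27 * ((C2 + C3) * (1 / n)) := by linarith
      _ = _ := by ring
  · rw [dv_add (sS1.add (sS2.cmul _)).sb (Rop_ST sr).sb, dv_add sS1.sb (sS2.cmul _).sb,
      dv_cmul sS2.sb, Rop_dv sr]
    have : Mn (fun q => h k q * cs n m s φ q) = Mn (r k) := by
      rw [show (fun q => h k q * cs n m s φ q) = fun q => (dv S1 k q + (1 / Lam n) * dv S2 k q) + r k q
        from funext fun q => key k q]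
      have t1 := dv_sb sS1.sb k
      have t2 := dv_sb sS2.sb k
      rw [Mn_add (t1.add (t2.cmul _)) (sr k), Mn_add t1 (t2.cmul _)]
      have : (fun q => 1 / Lam n * dv S2 k q) = dv (fun j k q => 1 / Lam n * S2 j k q) k :=
        funext fun q => (dv_cmul sS2.sb _ k q).symm
      rw [this, Mn_dv sS1.sb, Mn_dv (sS2.cmul _).sb]
      funext q
      simp
    rw [this, key k q]
    ring

end CI

namespace CI
open Set Filter Topology

variable {O : Set ℝ} {f g : STQ → ℝ} {n : ℕ}

/-- space integral at fixed time -/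
def J (f : STQ → ℝ) (t : ℝ) : ℝ := ∫ x in Tdom, f (t, x)

/-- space-time integral -/
def Iint (f : STQ → ℝ) : ℝ := ∫ t, J f t

lemma Tdom_ae : Tdom =ᵐ[volume] (Icc (0 : Spc) 1) := by
  unfold Tdom
  exact Measure.univ_pi_Ico_ae_eq_Icc (μ := fun _ : Fin 3 => (volume : Measure ℝ)) (f := 0) (g := 1)

lemma J_eq (f : STQ → ℝ) (t : ℝ) : J f t = ∫ x in Icc (0 : Spc) 1, f (t, x) :=
  setIntegral_congr_set Tdom_ae

lemma J_intble (hf : Continuous f) (t : ℝ) : IntegrableOn (fun x => f (t, x)) Tdom := by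
  refine IntegrableOn.congr_set_ae ?_ Tdom_ae
  exact ContinuousOn.integrableOn_compact isCompact_Icc (by fun_prop)

lemma vol_Tdom : volume.real Tdom = 1 := by
  have : volume.real Tdom = volume.real (Icc (0 : Spc) 1) := by
    simp only [measureReal_def]
    rw [measure_congr Tdom_ae]
  rw [this, measureReal_def, Real.volume_Icc_pi]
  simp

lemma J_add (hf : Continuous f) (hg : Continuous g) (t : ℝ) :
    J (fun q => f q + g q) t = J f t + J g t :=
  integral_add (J_intble hf t) (J_intble hg t)

lemma J_sub (hf : Continuous f) (hg : Continuous g) (t : ℝ) :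
    J (fun q => f q - g q) t = J f t - J g t :=
  integral_sub (J_intble hf t) (J_intble hg t)

lemma J_cmul (c : ℝ) (t : ℝ) : J (fun q => c * f q) t = c * J f t :=
  integral_const_mul _ _

lemma J_bound {C : ℝ} (h : ∀ q, |f q| ≤ C) (t : ℝ) : |J f t| ≤ C := by
  have := norm_setIntegral_le_of_norm_le_const (μ := volume) (s := Tdom) (f := fun x => f (t, x)) (C := C)
    (by rw [measure_congr Tdom_ae]; exact isCompact_Icc.measure_lt_top) (fun x _ => h (t, x))
  rw [vol_Tdom, mul_one] at this
  exact this

lemma J_cont (hf : Continuous f) : Continuous (J f) := by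
  have : J f = fun t => ∫ x in Icc (0 : Spc) 1, f (t, x) := funext (J_eq f)
  rw [this]
  exact continuous_parametric_integral_of_continuous (f := fun t x => f (t, x)) hf isCompact_Icc

def CS (F : STQ → ℝ) : Prop := Continuous F ∧ ∃ T : ℝ, ∀ q : STQ, T < |q.1| → F q = 0

lemma CS.add (hf : CS f) (hg : CS g) : CS (fun q => f q + g q) := by
  obtain ⟨h1, T, hT⟩ := hf
  obtain ⟨h2, T', hT'⟩ := hg
  exact ⟨h1.add h2, max T T', fun q hq => by
    simp [hT q (lt_of_le_of_lt (le_max_left _ _) hq), hT' q (lt_of_le_of_lt (le_max_right _ _) hq)]⟩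

lemma CS.mul (hf : Continuous f) (hg : CS g) : CS (fun q => f q * g q) := by
  obtain ⟨h2, T', hT'⟩ := hg
  exact ⟨hf.mul h2, T', fun q hq => by simp [hT' q hq]⟩

lemma CS.cmul (c : ℝ) (hg : CS g) : CS (fun q => c * g q) := CS.mul continuous_const hg

lemma CS.sub (hf : CS f) (hg : CS g) : CS (fun q => f q - g q) := by
  simpa only [sub_eq_add_neg, neg_one_mul] using hf.add (hg.cmul (-1))

lemma CS.zero : CS (fun _ => 0) := ⟨continuous_const, 0, fun _ _ => rfl⟩

lemma CS.sum {ι : Type*} (s : Finset ι) {F : ι → STQ → ℝ} (h : ∀ i, CS (F i)) :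
    CS (fun q => ∑ i ∈ s, F i q) := by
  classical
  induction s using Finset.induction_on with
  | empty => simpa using CS.zero
  | insert a s ha ih =>
    simp only [Finset.sum_insert ha]
    exact (h a).add ih

lemma CS.intble (hf : CS f) : Integrable (J f) := by
  obtain ⟨h1, T, hT⟩ := hf
  refine (J_cont h1).integrable_of_hasCompactSupport ?_
  refine HasCompactSupport.of_support_subset_isCompact (isCompact_Icc (a := -T) (b := T)) ?_
  intro t ht
  by_contra hh
  apply ht
  have : T < |t| := by
    by_contra h3
    exact hh (abs_le.1 (not_lt.1 h3))
  simp only [J]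
  simp [fun x => hT (t, x) this]

lemma Iint_add (hf : CS f) (hg : CS g) : Iint (fun q => f q + g q) = Iint f + Iint g := by
  unfold Iint
  rw [← integral_add hf.intble hg.intble]
  congr 1
  funext t
  exact J_add hf.1 hg.1 t

lemma Iint_cmul (c : ℝ) : Iint (fun q => c * f q) = c * Iint f := by
  unfold Iint
  rw [← integral_const_mul]
  congr 1
  funext t
  exact J_cmul c t

lemma Iint_sub (hf : CS f) (hg : CS g) : Iint (fun q => f q - g q) = Iint f - Iint g := by
  have := Iint_add hf (hg.cmul (-1))
  rw [Iint_cmul] at this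
  simpa only [sub_eq_add_neg, neg_one_mul] using this

lemma Iint_zero : Iint (fun _ => 0) = 0 := by simp [Iint, J]

lemma Iint_sum {ι : Type*} (s : Finset ι) {F : ι → STQ → ℝ} (h : ∀ i, CS (F i)) :
    Iint (fun q => ∑ i ∈ s, F i q) = ∑ i ∈ s, Iint (F i) := by
  classical
  induction s using Finset.induction_on with
  | empty => simpa using Iint_zero
  | insert a s ha ih =>
    simp only [Finset.sum_insert ha]
    rw [Iint_add (h a) (CS.sum s h), ih]

lemma D_cont (hf : ContDiff ℝ 1 f) (w : STQ) : Continuous (D w f) :=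
  (hf.continuous_fderiv (by simp)).clm_apply continuous_const

lemma J_DX (hf : ContDiff ℝ 1 f) (hp : PerQ f) (j : Fin 3) (t : ℝ) : J (D (eX j) f) t = 0 := by
  rw [J_eq]
  let F : Fin 3 → Spc → ℝ := fun i x => if i = j then f (t, x) else 0
  let F' : Fin 3 → Spc → Spc →L[ℝ] ℝ := fun i x =>
    if i = j then (fderiv ℝ f (t, x)).comp (ContinuousLinearMap.inr ℝ ℝ Spc) else 0
  have hd : ∀ x i, HasFDerivAt (F i) (F' i x) x := by
    intro x i
    by_cases h : i = j
    · simp only [F, F', h, if_true]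
      have h1 : HasFDerivAt (fun x : Spc => ((t, x) : STQ)) (ContinuousLinearMap.inr ℝ ℝ Spc) x :=
        hasFDerivAt_prodMk_right t x
      exact ((hf.differentiable (by simp)) (t, x)).hasFDerivAt.comp x h1
    · simp only [F, F', h, if_false]
      exact hasFDerivAt_const _ _
  have hsum : ∀ x, ∑ i, F' i x (Pi.single i 1) = D (eX j) f (t, x) := by
    intro x
    have : ∀ i, F' i x (Pi.single i 1) = if i = j then D (eX j) f (t, x) else 0 := by
      intro i
      by_cases h : i = j
      · subst h; simp [F', D, eX]
      · simp [F', h]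
    simp [this]
  have := integral_divergence_of_hasFDerivAt_off_countable' (n := 2) (0 : Spc) 1 (by intro i; simp) F F' ∅
    countable_empty (fun i => (continuous_iff_continuousAt.2 fun x => (hd x i).continuousAt).continuousOn)
    (fun x _ i => hd x i) ?_
  · rw [setIntegral_congr_fun measurableSet_Icc (fun x _ => (hsum x).symm)]
    rw [this]
    refine Finset.sum_eq_zero fun i _ => ?_
    rw [sub_eq_zero]
    congr 1
    funext x
    simp only [F]
    by_cases h : i = j
    · subst h
      simp only [if_true]
      rw [← hp (t, i.insertNth ((0 : Spc) i) x) (Pi.single i 1)]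
      congr 2
      funext k
      rcases Fin.eq_self_or_eq_succAbove i k with h | ⟨k', h⟩
      · subst h; simp
      · subst h; simp
    · simp [h]
  · simp only [hsum]
    refine ContinuousOn.integrableOn_compact isCompact_Icc ?_
    have := D_cont hf (eX j)
    fun_prop

lemma CS.D (hf : ContDiff ℝ 1 f) (hs : CS f) (w : STQ) : CS (D w f) := by
  refine ⟨D_cont hf w, ?_⟩
  obtain ⟨h1, T, hT⟩ := hs
  refine ⟨T, fun q hq => ?_⟩
  have : f =ᶠ[𝓝 q] fun _ => 0 := by
    have ho : IsOpen {q : STQ | T < |q.1|} := isOpen_lt continuous_const (by fun_prop)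
    filter_upwards [ho.mem_nhds hq] with q' hq'
    exact hT q' hq'
  simp [CI.D, this.fderiv_eq]

lemma Iint_DX (hf : ContDiff ℝ 1 f) (hp : PerQ f) (j : Fin 3) : Iint (D (eX j) f) = 0 := by
  simp [Iint, J_DX hf hp j]

lemma Iint_DT (hf : ContDiff ℝ 1 f) (hs : CS f) : Iint (D eT f) = 0 := by
  have hD := hs.D hf eT
  obtain ⟨hc, T, hT⟩ := hD
  obtain ⟨hc', T', hT'⟩ := hs
  have hI : Integrable (Function.uncurry fun t x => D eT f (t, x)) (volume.prod (volume.restrict Tdom)) := by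
    have e : (volume : Measure ℝ).prod ((volume : Measure Spc).restrict Tdom) =
        (volume : Measure (ℝ × Spc)).restrict (univ ×ˢ Tdom) := by
      rw [Measure.volume_eq_prod, ← Measure.prod_restrict, Measure.restrict_univ]
    rw [e]
    have h1 : IntegrableOn (D eT f) (Icc (-T) T ×ˢ Icc (0:Spc) 1) :=
      ContinuousOn.integrableOn_compact (isCompact_Icc.prod isCompact_Icc) hc.continuousOn
    have hm : MeasurableSet (univ ×ˢ Tdom : Set (ℝ × Spc)) :=
      MeasurableSet.univ.prod (MeasurableSet.univ_pi fun _ => measurableSet_Ico)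
    refine IntegrableOn.of_forall_sdiff_eq_zero h1 hm ?_
    rintro ⟨t, x⟩ ⟨⟨_, hx⟩, h⟩
    apply hT
    by_contra h3
    apply h
    refine ⟨abs_le.1 (not_lt.1 h3), ?_⟩
    exact ⟨fun i => (hx i (mem_univ i)).1, fun i => (hx i (mem_univ i)).2.le⟩
  unfold Iint J
  rw [integral_integral_swap hI]
  have : ∀ x, ∫ t, D eT f (t, x) = 0 := by
    intro x
    refine integral_eq_zero_of_hasDerivAt_of_integrable (f := fun t => f (t, x)) (fun t => ?_) ?_ ?_
    · have := hasDerivAt_line (hf.differentiable (by simp)) eT (0, x) t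
      simpa [eT] using this
    · refine Continuous.integrable_of_hasCompactSupport (by fun_prop) ?_
      refine HasCompactSupport.of_support_subset_isCompact (isCompact_Icc (a := -T) (b := T)) ?_
      intro t ht
      by_contra hh
      exact ht (hT (t, x) (by by_contra h3; exact hh (abs_le.1 (not_lt.1 h3))))
    · refine Continuous.integrable_of_hasCompactSupport (by fun_prop) ?_
      refine HasCompactSupport.of_support_subset_isCompact (isCompact_Icc (a := -T') (b := T')) ?_
      intro t ht
      by_contra hh
      exact ht (hT' (t, x) (by by_contra h3; exact hh (abs_le.1 (not_lt.1 h3))))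
  simp [this]

end CI

namespace CI
open Set Filter Topology

variable {O : Set ℝ} {f g : STQ → ℝ} {n : ℕ}

lemma SB.c1 (hf : SB O f) : ContDiff ℝ 1 f := by exact_mod_cast hf.contDiff_nat 1

/-- oscillatory integrals decay -/
lemma J_osc (hf : SB O f) (m : Fin 3) (s : ℝ) :
    ∃ C, 0 ≤ C ∧ ∀ n : ℕ, 1 ≤ n → ∀ φ t, |J (fun q => f q * cs n m s φ q) t| ≤ C / n := by
  obtain ⟨C, hC⟩ := (hf.D (eX m)).bas.bdd
  have hC0 : 0 ≤ C := (abs_nonneg _).trans (hC 0)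
  refine ⟨C, hC0, fun n hn φ t => ?_⟩
  obtain ⟨h1, h2⟩ := Lam_pos hn
  have hL : 0 < Lam n := by linarith
  have hn0 : (0:ℝ) < n := by exact_mod_cast hn
  have hcs := cs_SB n m s (φ - Real.pi / 2)
  have hp : SB O (fun q => f q * cs n m s (φ - Real.pi / 2) q) := hf.mul' hcs
  have e : (fun q => f q * cs n m s φ q) = fun q =>
      (1 / Lam n) * (D (eX m) (fun q => f q * cs n m s (φ - Real.pi / 2) q) q -
        D (eX m) f q * cs n m s (φ - Real.pi / 2) q) := by
    funext q
    rw [hf.D_mul hcs, cs_DX, dl_self]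
    simp only [sub_add_cancel]
    field_simp
    ring
  rw [e, J_cmul, J_sub (hp.D _).cont ((hf.D _).mul' hcs).cont, J_DX hp.c1 hp.bas.per, zero_sub, abs_mul,
    abs_neg, abs_of_nonneg (by positivity)]
  have : |J (fun q => D (eX m) f q * cs n m s (φ - Real.pi / 2) q) t| ≤ C := by
    refine J_bound (fun q => ?_) t
    rw [abs_mul]
    have := cs_abs n m s (φ - Real.pi / 2) q
    have := hC q
    calc _ ≤ C * 1 := by gcongr
      _ = C := mul_one C
  calc 1 / Lam n * |J (fun q => D (eX m) f q * cs n m s (φ - Real.pi / 2) q) t| ≤ 1 / n * C := by gcongr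
    _ = C / n := by ring

/-- scalar test functions -/
structure TF (φ : STQ → ℝ) : Prop where
  smooth : ContDiff ℝ (⊤ : ℕ∞) φ
  per : PerQ φ
  supp : ∃ T : ℝ, ∀ q : STQ, T < |q.1| → φ q = 0

lemma TF.c1 (h : TF f) : ContDiff ℝ 1 f := h.smooth.of_le (by exact_mod_cast le_top)
lemma TF.cs (h : TF f) : CS f := ⟨h.smooth.continuous, h.supp⟩
lemma TF.csD (h : TF f) (w : STQ) : CS (D w f) := h.cs.D h.c1 w

lemma ibp_aux (hf : SB O f) (hg : TF g) (w : STQ) (h0 : Iint (D w (fun q => f q * g q)) = 0) :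
    Iint (fun q => f q * D w g q) = - Iint (fun q => D w f q * g q) := by
  rw [D_mul hf.diff (hg.c1.differentiable (by simp)), Iint_add (CS.mul hf.cont (hg.csD w))
    (CS.mul (hf.D w).cont hg.cs)] at h0
  linarith

lemma ibpX (hf : SB O f) (hg : TF g) (j : Fin 3) :
    Iint (fun q => f q * D (eX j) g q) = - Iint (fun q => D (eX j) f q * g q) := by
  refine ibp_aux hf hg _ (Iint_DX (hf.c1.mul hg.c1) ?_ j)
  intro q k
  simp only [hf.bas.per q k, hg.per q k]

lemma ibpT (hf : SB O f) (hg : TF g) :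
    Iint (fun q => f q * D eT g q) = - Iint (fun q => D eT f q * g q) :=
  ibp_aux hf hg _ (Iint_DT (hf.c1.mul hg.c1) (CS.mul hf.cont hg.cs))

def WER (v : Fin 3 → STQ → ℝ) (p : STQ → ℝ) (R : Fin 3 → Fin 3 → STQ → ℝ) : Prop :=
  (∀ φ : Fin 3 → STQ → ℝ, (∀ l, TF (φ l)) →
    Iint (fun q => (∑ l, v l q * D eT (φ l) q) + (∑ j, ∑ l, v j q * v l q * D (eX j) (φ l) q) +
      p q * (∑ j, D (eX j) (φ j) q) - (∑ j, ∑ l, R j l q * D (eX j) (φ l) q)) = 0) ∧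
  (∀ ψ, TF ψ → Iint (fun q => ∑ j, v j q * D (eX j) ψ q) = 0)

lemma WER.pshift {v : Fin 3 → STQ → ℝ} {p : STQ → ℝ} {R : Fin 3 → Fin 3 → STQ → ℝ} (h : WER v p R)
    (r : STQ → ℝ) : WER v (fun q => p q + r q) (fun j l q => R j l q + dl j l * r q) := by
  refine ⟨fun φ hφ => ?_, h.2⟩
  rw [← h.1 φ hφ]
  congr 1
  funext q
  simp [Fin.sum_univ_three, dl]
  ring

lemma WER.congr {v v' : Fin 3 → STQ → ℝ} {p p' : STQ → ℝ} {R R' : Fin 3 → Fin 3 → STQ → ℝ} (h : WER v p R)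
    (hv : ∀ j q, v j q = v' j q) (hp : ∀ q, p q = p' q) (hR : ∀ j l q, R j l q = R' j l q) : WER v' p' R' := by
  have e1 : v = v' := funext fun j => funext fun q => hv j q
  have e2 : p = p' := funext hp
  have e3 : R = R' := funext fun j => funext fun l => funext fun q => hR j l q
  subst e1 e2 e3
  exact h

lemma WER.update {v : Fin 3 → STQ → ℝ} {p : STQ → ℝ} {R : Fin 3 → Fin 3 → STQ → ℝ} (h : WER v p R)
    (cv : ∀ j, Continuous (v j)) (cp : Continuous p) (cR : ∀ j l, Continuous (R j l))
    {V : Fin 3 → STQ → ℝ} {X S N : Fin 3 → Fin 3 → STQ → ℝ} (sV : ∀ l, SB O (V l))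
    (sX : ∀ j l, SB O (X j l)) (sS : ∀ j l, SB O (S j l))
    (hE : ∀ l q, D eT (V l) q + dv X l q = dv S l q) (hdiv : ∀ q, ∑ j, D (eX j) (V j) q = 0)
    (hX : ∀ j l q, (v j q + V j q) * (v l q + V l q) = v j q * v l q + X j l q + N j l q) :
    WER (fun l q => v l q + V l q) p (fun j l q => R j l q + N j l q + S j l q) := by
  constructor
  · intro φ hφ
    have h1 := h.1 φ hφ
    have cT : ∀ l, CS (fun q => V l q * D eT (φ l) q) := fun l => CS.mul (sV l).cont ((hφ l).csD _)
    have cX : ∀ j l, CS (fun q => (X j l q - S j l q) * D (eX j) (φ l) q) :=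
      fun j l => CS.mul ((sX j l).sub (sS j l)).cont ((hφ l).csD _)
    have c1 : CS (fun q => (∑ l, v l q * D eT (φ l) q) + (∑ j, ∑ l, v j q * v l q * D (eX j) (φ l) q) +
      p q * (∑ j, D (eX j) (φ j) q) - (∑ j, ∑ l, R j l q * D (eX j) (φ l) q)) :=
      (((CS.sum _ fun l => CS.mul (cv l) ((hφ l).csD _)).add
        (CS.sum _ fun j => CS.sum _ fun l => CS.mul ((cv j).mul (cv l)) ((hφ l).csD _))).add
        (CS.mul cp (CS.sum _ fun j => (hφ j).csD _))).sub
        (CS.sum _ fun j => CS.sum _ fun l => CS.mul (cR j l) ((hφ l).csD _))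
    have c2 : CS (fun q => (∑ l, V l q * D eT (φ l) q) +
      (∑ j, ∑ l, (X j l q - S j l q) * D (eX j) (φ l) q)) :=
      (CS.sum _ cT).add (CS.sum _ fun j => CS.sum _ fun l => cX j l)
    have e : (fun q => (∑ l, (v l q + V l q) * D eT (φ l) q) +
        (∑ j, ∑ l, (v j q + V j q) * (v l q + V l q) * D (eX j) (φ l) q) +
        p q * (∑ j, D (eX j) (φ j) q) - (∑ j, ∑ l, (R j l q + N j l q + S j l q) * D (eX j) (φ l) q)) =
        fun q => ((∑ l, v l q * D eT (φ l) q) + (∑ j, ∑ l, v j q * v l q * D (eX j) (φ l) q) +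
      p q * (∑ j, D (eX j) (φ j) q) - (∑ j, ∑ l, R j l q * D (eX j) (φ l) q)) +
      ((∑ l, V l q * D eT (φ l) q) + (∑ j, ∑ l, (X j l q - S j l q) * D (eX j) (φ l) q)) := by
      funext q
      simp only [hX, Fin.sum_univ_three]
      ring
    rw [e, Iint_add c1 c2, h1, zero_add, Iint_add (CS.sum _ cT) (CS.sum _ fun j => CS.sum _ fun l => cX j l),
      Iint_sum _ cT, Iint_sum _ (fun j => CS.sum _ fun l => cX j l)]
    have : ∀ j, Iint (fun q => ∑ l, (X j l q - S j l q) * D (eX j) (φ l) q) =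
        - ∑ l, Iint (fun q => D (eX j) (fun q => X j l q - S j l q) q * φ l q) := by
      intro j
      rw [Iint_sum _ (cX j), ← Finset.sum_neg_distrib]
      refine Finset.sum_congr rfl fun l _ => ?_
      exact ibpX ((sX j l).sub (sS j l)) (hφ l) j
    simp only [this, ibpT (sV _) (hφ _)]
    rw [Finset.sum_neg_distrib, Finset.sum_neg_distrib, Finset.sum_comm, ← neg_add, neg_eq_zero,
      ← Finset.sum_add_distrib]
    refine Finset.sum_eq_zero fun l _ => ?_
    rw [← Iint_sum _ (fun j => CS.mul (((sX j l).sub (sS j l)).D _).cont (hφ l).cs),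
      ← Iint_add (CS.mul ((sV l).D _).cont (hφ l).cs)
        (CS.sum _ fun j => CS.mul (((sX j l).sub (sS j l)).D _).cont (hφ l).cs)]
    rw [← Iint_zero]
    congr 1
    funext q
    have := hE l q
    rw [← Finset.sum_mul, ← add_mul]
    have h2 : ∑ j, D (eX j) (fun q => X j l q - S j l q) q = dv X l q - dv S l q := by
      unfold dv
      rw [← Finset.sum_sub_distrib]
      refine Finset.sum_congr rfl fun j _ => ?_
      rw [(sX j l).D_sub (sS j l)]
    rw [h2]
    have : D eT (V l) q + (dv X l q - dv S l q) = 0 := by linarith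
    rw [this, zero_mul]
  · intro ψ hψ
    have c1 : ∀ j, CS (fun q => v j q * D (eX j) ψ q) := fun j => CS.mul (cv j) (hψ.csD _)
    have c2 : ∀ j, CS (fun q => V j q * D (eX j) ψ q) := fun j => CS.mul (sV j).cont (hψ.csD _)
    simp only [add_mul, Finset.sum_add_distrib]
    rw [Iint_add (CS.sum _ c1) (CS.sum _ c2), h.2 ψ hψ, zero_add, Iint_sum _ c2]
    simp only [ibpX (sV _) hψ]
    rw [Finset.sum_neg_distrib, ← Iint_sum _ (fun j => CS.mul ((sV j).D _).cont hψ.cs), neg_eq_zero,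
      ← Iint_zero]
    congr 1
    funext q
    rw [← Finset.sum_mul, hdiv q, zero_mul]

lemma TF_of_test {E : Type*} [NormedAddCommGroup E] [NormedSpace ℝ E] {φ : ℝ → Spc → E} (h : IsTest φ)
    (L : E →L[ℝ] ℝ) : TF (fun q => L (φ q.1 q.2)) := by
  obtain ⟨h1, h2, T, h3⟩ := h
  refine ⟨L.contDiff.comp h1, fun q k => ?_, T, fun q hq => ?_⟩
  · simp only [h2 q.1 q.2 k]
  · simp only [h3 q.1 hq q.2, map_zero]

lemma pt_eq (hf : Differentiable ℝ f) (t : ℝ) (x : Spc) : pt (fun s y => f (s, y)) t x = D eT f (t, x) := by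
  have := hasDerivAt_line hf eT (0, x) t
  simp only [pt]
  have h2 : HasDerivAt (fun s => f (s, x)) (D eT f (t, x)) t := by simpa [eT] using this
  exact h2.deriv

lemma pd_eq (hf : Differentiable ℝ f) (j : Fin 3) (t : ℝ) (x : Spc) :
    pd j (fun y => f (t, y)) x = D (eX j) f (t, x) := by
  have h1 : HasFDerivAt (fun x : Spc => ((t, x) : STQ)) (ContinuousLinearMap.inr ℝ ℝ Spc) x :=
    hasFDerivAt_prodMk_right t x
  have := ((hf (t, x)).hasFDerivAt.comp x h1).fderiv
  simp only [pd]
  change fderiv ℝ (f ∘ fun y => (t, y)) x _ = _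
  rw [this]
  simp [D, eX]

lemma WER_iff {v : ℝ → Spc → Spc} {p : ℝ → Spc → ℝ} {R : ℝ → Spc → Fin 3 → Fin 3 → ℝ} :
    IsWeakEulerReynolds v p R ↔
      WER (fun l q => v q.1 q.2 l) (fun q => p q.1 q.2) (fun j l q => R q.1 q.2 j l) := by
  constructor
  · rintro ⟨h1, h2⟩
    refine ⟨fun φ hφ => ?_, fun ψ hψ => ?_⟩
    · have hT : IsTest (fun t x l => φ l (t, x)) := by
        refine ⟨contDiff_pi.2 fun l => (hφ l).smooth, fun t x k => ?_, ?_⟩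
        · funext l
          exact (hφ l).per (t, x) k
        · choose T hT using fun l => (hφ l).supp
          refine ⟨max (T 0) (max (T 1) (T 2)), fun t ht x => ?_⟩
          rw [max_lt_iff, max_lt_iff] at ht
          funext l
          fin_cases l
          · exact hT 0 (t, x) ht.1
          · exact hT 1 (t, x) ht.2.1
          · exact hT 2 (t, x) ht.2.2
      have := h1 _ hT
      have hd : ∀ l, Differentiable ℝ (φ l) := fun l => (hφ l).c1.differentiable (by simp)
      simp only [pt_eq (hd _), pd_eq (hd _)] at this
      exact this
    · have hT : IsTest (fun t x => ψ (t, x)) := ⟨hψ.smooth, fun t x k => hψ.per (t, x) k,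
        hψ.supp.imp fun T h t ht x => h (t, x) ht⟩
      have := h2 _ hT
      simp only [pd_eq (hψ.c1.differentiable (by simp))] at this
      exact this
  · rintro ⟨h1, h2⟩
    refine ⟨fun φ hφ => ?_, fun ψ hψ => ?_⟩
    · have hT := fun l => TF_of_test hφ (ContinuousLinearMap.proj (R := ℝ) (φ := fun _ : Fin 3 => ℝ) l)
      have := h1 _ hT
      have hd : ∀ l, Differentiable ℝ (fun q : STQ => φ q.1 q.2 l) := fun l => (hT l).c1.differentiable (by simp)
      have e1 : ∀ l t x, pt (fun s y => φ s y l) t x = D eT (fun q : STQ => φ q.1 q.2 l) (t, x) :=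
        fun l t x => pt_eq (hd l) t x
      have e2 : ∀ j l t x, pd j (fun y => φ t y l) x = D (eX j) (fun q : STQ => φ q.1 q.2 l) (t, x) :=
        fun j l t x => pd_eq (hd l) j t x
      simp only [e1, e2]
      exact this
    · have hT := TF_of_test hψ (ContinuousLinearMap.id ℝ ℝ)
      have := h2 _ hT
      have hd : Differentiable ℝ (fun q : STQ => ψ q.1 q.2) := hT.c1.differentiable (by simp)
      have e2 : ∀ j t x, pd j (ψ t) x = D (eX j) (fun q : STQ => ψ q.1 q.2) (t, x) :=
        fun j t x => pd_eq hd j t x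
      simp only [e2]
      exact this

end CI

namespace CI
open Set Filter Topology

variable {O : Set ℝ} {f g : STQ → ℝ} {n : ℕ}

structure Good (O : Set ℝ) (f : STQ → ℝ) : Prop where
  uc : UniformContinuous f
  per : PerQ f
  bdd : ∃ C, ∀ q, |f q| ≤ C
  van : ∀ q : STQ, q.1 ∈ O → f q = 0

lemma SB.good (h : SB O f) : Good O f := ⟨h.uc, h.bas.per, h.bas.bdd, h.bas.van⟩
lemma Good.cont (h : Good O f) : Continuous f := h.uc.continuous
lemma Good.mono {O' : Set ℝ} (hO : O' ⊆ O) (hf : Good O f) : Good O' f :=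
  ⟨hf.uc, hf.per, hf.bdd, fun q hq => hf.van q (hO hq)⟩
lemma Good.e (hf : Good O f) : Good ∅ f := hf.mono (empty_subset _)

lemma Good.add (hf : Good O f) (hg : Good O g) : Good O (fun q => f q + g q) := by
  obtain ⟨C, hC⟩ := hf.bdd
  obtain ⟨C', hC'⟩ := hg.bdd
  refine ⟨hf.uc.add hg.uc, fun q k => ?_, ⟨C + C', fun q => (abs_add_le _ _).trans (add_le_add (hC q) (hC' q))⟩,
    fun q hq => ?_⟩
  · simp only [hf.per q k, hg.per q k]
  · simp only [hf.van q hq, hg.van q hq, add_zero]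

lemma Good.mul {O' : Set ℝ} (hf : Good O' f) (hg : Good O g) : Good O (fun q => f q * g q) := by
  obtain ⟨C, hC⟩ := hf.bdd
  obtain ⟨C', hC'⟩ := hg.bdd
  have hC0 : 0 ≤ C := (abs_nonneg _).trans (hC 0)
  have hC0' : 0 ≤ C' := (abs_nonneg _).trans (hC' 0)
  refine ⟨?_, fun q k => ?_, ⟨C * C', fun q => ?_⟩, fun q hq => ?_⟩
  · rw [Metric.uniformContinuous_iff]
    intro ε hε
    have h1 := Metric.uniformContinuous_iff.1 hf.uc (ε / (2 * (C' + 1))) (by positivity)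
    have h2 := Metric.uniformContinuous_iff.1 hg.uc (ε / (2 * (C + 1))) (by positivity)
    obtain ⟨d1, p1, h1⟩ := h1
    obtain ⟨d2, p2, h2⟩ := h2
    refine ⟨min d1 d2, lt_min p1 p2, fun {a b} hab => ?_⟩
    have h1 := h1 (lt_of_lt_of_le hab (min_le_left _ _))
    have h2 := h2 (lt_of_lt_of_le hab (min_le_right _ _))
    rw [Real.dist_eq] at h1 h2 ⊢
    have e : f a * g a - f b * g b = f a * (g a - g b) + (f a - f b) * g b := by ring
    rw [e]
    refine (abs_add_le _ _).trans_lt ?_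
    rw [abs_mul, abs_mul]
    have k1 : |f a| * |g a - g b| < ε / 2 := by
      calc |f a| * |g a - g b| ≤ C * |g a - g b| := by gcongr; exact hC a
        _ ≤ (C + 1) * |g a - g b| := by gcongr; linarith
        _ < (C + 1) * (ε / (2 * (C + 1))) := by gcongr
        _ = ε / 2 := by field_simp
    have k2 : |f a - f b| * |g b| < ε / 2 := by
      calc |f a - f b| * |g b| ≤ |f a - f b| * C' := by gcongr; exact hC' b
        _ ≤ |f a - f b| * (C' + 1) := by gcongr; linarith
        _ < (ε / (2 * (C' + 1))) * (C' + 1) := by gcongr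
        _ = ε / 2 := by field_simp
    linarith
  · simp only [hf.per q k, hg.per q k]
  · rw [abs_mul]
    have := hC q
    have := hC' q
    gcongr
  · simp only [hg.van q hq, mul_zero]

lemma Good.mul' {O' : Set ℝ} (hf : Good O f) (hg : Good O' g) : Good O (fun q => f q * g q) := by
  have := hg.mul hf
  simpa only [mul_comm] using this

lemma Good.cmul (c : ℝ) (hf : Good O f) : Good O (fun q => c * f q) := (SB.const c).good.mul hf
lemma Good.zero : Good O (fun _ => 0) := SB.zero.good

lemma Good.sub (hf : Good O f) (hg : Good O g) : Good O (fun q => f q - g q) := by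
  simpa only [sub_eq_add_neg, neg_one_mul] using hf.add (hg.cmul (-1))

lemma Good.sum {ι : Type*} (s : Finset ι) {F : ι → STQ → ℝ} (h : ∀ i ∈ s, Good O (F i)) :
    Good O (fun q => ∑ i ∈ s, F i q) := by
  classical
  induction s using Finset.induction_on with
  | empty => simpa using Good.zero
  | insert a s ha ih =>
    simp only [Finset.sum_insert ha]
    exact (h a (by simp)).add (ih fun i hi => h i (by simp [hi]))

lemma haarQ : (volume : Measure STQ).IsAddHaarMeasure :=
  inferInstanceAs ((volume : Measure ℝ).prod (volume : Measure Spc)).IsAddHaarMeasure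

open scoped Convolution in
lemma moll (hf : Good ∅ f) {δ : ℝ} (hδ : 0 < δ) : ∃ g, SB ∅ g ∧ ∀ q, |g q - f q| ≤ δ := by
  obtain ⟨r, hr, h⟩ := Metric.uniformContinuous_iff.1 hf.uc δ hδ
  obtain ⟨C, hC⟩ := hf.bdd
  haveI := haarQ
  let b : ContDiffBump (0 : STQ) := ⟨r / 2, r, by positivity, by linarith⟩
  let L : ℝ →L[ℝ] ℝ →L[ℝ] ℝ := (ContinuousLinearMap.lsmul ℝ ℝ).flip
  have hLI : LocallyIntegrable f volume := hf.cont.locallyIntegrable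
  have key : ∀ n, ∀ ψ : STQ → ℝ, ContDiff ℝ (⊤ : ℕ∞) ψ → HasCompactSupport ψ →
      BC ∅ n (f ⋆[L, volume] ψ) := by
    have hbas : ∀ ψ : STQ → ℝ, ContDiff ℝ (⊤ : ℕ∞) ψ → HasCompactSupport ψ →
      Bas ∅ (f ⋆[L, volume] ψ) := by
      intro ψ h1 h2
      refine ⟨h2.continuous_convolution_right L hLI h1.continuous, ⟨C * ∫ t, ‖ψ t‖, fun q => ?_⟩,
        fun q k => ?_, by simp⟩
      · rw [convolution_eq_swap, ← integral_const_mul, ← Real.norm_eq_abs]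
        refine norm_integral_le_of_norm_le ((h1.continuous.integrable_of_hasCompactSupport h2).norm.const_mul C)
          (Eventually.of_forall fun t => ?_)
        simp only [L, ContinuousLinearMap.flip_apply, ContinuousLinearMap.lsmul_apply, smul_eq_mul, norm_mul]
        rw [mul_comm]
        gcongr
        exact hC _
      · rw [convolution_eq_swap, convolution_eq_swap]
        congr 1
        funext t
        have := hf.per (q - t) k
        congr 2
        rw [← this]
        congr 1
        refine Prod.ext rfl ?_
        funext i
        simp
        ring
    intro n
    induction n with
    | zero => exact hbas
    | succ n ih =>
      intro ψ h1 h2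
      have hc1 : ContDiff ℝ 1 ψ := h1.of_le (by exact_mod_cast le_top)
      have hD : ∀ q, HasFDerivAt (f ⋆[L, volume] ψ) _ q := fun q =>
        h2.hasFDerivAt_convolution_right L hLI hc1 q
      refine ⟨hbas ψ h1 h2, fun q => (hD q).differentiableAt, fun w => ?_⟩
      have e : D w (f ⋆[L, volume] ψ) = f ⋆[L, volume] (D w ψ) := by
        funext q
        simp only [D]
        rw [(hD q).fderiv]
        exact convolution_precompR_apply L hLI (h2.fderiv ℝ) (hc1.continuous_fderiv (by simp)) q w
      rw [e]
      refine ih _ ?_ ?_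
      · exact (h1.fderiv_right (m := (⊤ : ℕ∞)) (by simp)).clm_apply contDiff_const
      · exact h2.fderiv_apply ℝ w
  refine ⟨f ⋆[L, volume] (b.normed volume), fun n => key n _ b.contDiff_normed b.hasCompactSupport_normed,
    fun q => ?_⟩
  have := b.dist_normed_convolution_le (μ := volume) (g := f) (x₀ := q) (ε := δ)
    hf.cont.aestronglyMeasurable (fun x hx => (h hx).le)
  rw [← convolution_flip, Real.dist_eq] at this
  exact this

end CI

namespace CI
open Set Filter Topology

variable {O : Set ℝ} {f g : STQ → ℝ} {n : ℕ}

def r2 : ℝ := Real.sqrt 2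
lemma r2_sq : r2 * r2 = 2 := Real.mul_self_sqrt (by norm_num)
lemma r2_pos : 0 ≤ r2 := Real.sqrt_nonneg 2
lemma r2_le : r2 ≤ 3 / 2 := by
  unfold r2
  rw [Real.sqrt_le_left (by norm_num)]
  norm_num

lemma cs_half (n : ℕ) (m : Fin 3) (s : ℝ) (q : STQ) :
    cs n m s (0 + Real.pi / 2) q = - cs n m s (-(Real.pi / 2)) q := by
  simp only [cs, zero_add, Real.cos_add_pi_div_two, ← sub_eq_add_neg, Real.cos_sub_pi_div_two]

lemma cs_sq (n : ℕ) (m : Fin 3) (s : ℝ) (q : STQ) :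
    2 * (cs n m s 0 q * cs n m s 0 q) = 1 + cs (2 * n) m s 0 q := by
  simp only [cs, add_zero, Lam]
  have := Real.cos_two_mul (2 * Real.pi * n * (q.2 m - s * q.1))
  rw [show 2 * Real.pi * ((2 * n : ℕ) : ℝ) * (q.2 m - s * q.1) = 2 * (2 * Real.pi * n * (q.2 m - s * q.1)) by
    push_cast; ring, this]
  ring

lemma DX_hcs (hf : SB O f) (n : ℕ) (m : Fin 3) (s φ : ℝ) (j : Fin 3) (q : STQ) :
    D (eX j) (fun q => f q * cs n m s φ q) q =
      D (eX j) f q * cs n m s φ q + dl j m * (Lam n * f q * cs n m s (φ + Real.pi / 2) q) := by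
  rw [hf.D_mul (cs_SB _ _ _ _), cs_DX]
  ring

lemma DT_hcs (hf : SB O f) (n : ℕ) (m : Fin 3) (s φ : ℝ) (q : STQ) :
    D eT (fun q => f q * cs n m s φ q) q =
      D eT f q * cs n m s φ q - s * (Lam n * f q * cs n m s (φ + Real.pi / 2) q) := by
  rw [hf.D_mul (cs_SB _ _ _ _), cs_DT]
  ring

section wave
variable (n : ℕ) (m : Fin 3) (b : Fin 3 → ℝ) (s : ℝ) (A : STQ → ℝ) (u : Fin 3 → STQ → ℝ)

def kap (j l : Fin 3) : ℝ := dl j m * b l - b j * dl l m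
def Kap (j l : Fin 3) : ℝ := dl j m * b l + b j * dl l m
def Om (j l : Fin 3) : STQ → ℝ := fun q =>
  (kap m b j l * r2 * (1 / Lam n)) * (A q * cs n m s (-(Real.pi / 2)) q)
def Vw (l : Fin 3) : STQ → ℝ := dv (Om n m b s A) l
def ww (l : Fin 3) : STQ → ℝ := fun q => ∑ j, kap m b j l * D (eX j) A q
def Ww (l : Fin 3) : STQ → ℝ := fun q => r2 * (ww m b A l q * cs n m s (-(Real.pi / 2)) q)
def Pw (j l : Fin 3) : STQ → ℝ := fun q => r2 * (A q * (u j q * b l + b j * u l q))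
def Qw (j l : Fin 3) : STQ → ℝ := fun q => b j * b l * (A q * A q)
def Gw : STQ → ℝ := fun q => r2 * ((u m q - s) * A q)
def Tw (j l : Fin 3) : STQ → ℝ := fun q => Kap m b j l * (Gw m s A u q * cs n m s 0 q)
def X0 (j l : Fin 3) : STQ → ℝ := fun q =>
  Pw b A u j l q * cs n m s 0 q + Qw b A j l q * cs (2 * n) m s 0 q
def Yw (j l : Fin 3) : STQ → ℝ := fun q =>
  u j q * Ww n m b s A l q + Ww n m b s A j q * u l q +
    r2 * (A q * cs n m s 0 q) * (b j * Ww n m b s A l q + Ww n m b s A j q * b l) +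
    1 / Lam n * (Ww n m b s A j q * Ww n m b s A l q)
def f0 (l : Fin 3) : STQ → ℝ := fun q =>
  r2 * (b l * D eT A q - s * ww m b A l q) + dv (Pw b A u) l q - ∑ j, Kap m b j l * D (eX j) (Gw m s A u) q
def f1 (l : Fin 3) : STQ → ℝ := dv (Qw b A) l
def f2 (l : Fin 3) : STQ → ℝ := fun q => r2 * D eT (ww m b A l) q

variable {n m b s A u}

lemma Om_SB (hA : SB O A) (j l : Fin 3) : SB O (Om n m b s A j l) := (hA.mul' (cs_SB _ _ _ _)).cmul _
lemma Vw_SB (hA : SB O A) (l : Fin 3) : SB O (Vw n m b s A l) := dv_sb (Om_SB hA) l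
lemma ww_SB (hA : SB O A) (l : Fin 3) : SB O (ww m b A l) := SB.sum _ fun j _ => (hA.D _).cmul _
lemma Ww_SB (hA : SB O A) (l : Fin 3) : SB O (Ww n m b s A l) := ((ww_SB hA l).mul' (cs_SB _ _ _ _)).cmul _
lemma Pw_SB (hA : SB O A) (hu : ∀ l, SB ∅ (u l)) (j l : Fin 3) : SB O (Pw b A u j l) :=
  (hA.mul' (((hu j).mulc _).add ((hu l).cmul _))).cmul _
lemma Qw_SB (hA : SB O A) (j l : Fin 3) : SB O (Qw b A j l) := (hA.mul hA).cmul _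
lemma Gw_SB (hA : SB O A) (hu : ∀ l, SB ∅ (u l)) : SB O (Gw m s A u) := (((hu m).sub (SB.const s)).mul hA).cmul _
lemma Tw_ST (hA : SB O A) (hu : ∀ l, SB ∅ (u l)) : ST O (Tw n m b s A u) :=
  ⟨fun j l => ((Gw_SB hA hu).mul' (cs_SB _ _ _ _)).cmul _, fun j l q => by simp only [Tw, Kap]; ring⟩
lemma X0_SB (hA : SB O A) (hu : ∀ l, SB ∅ (u l)) (j l : Fin 3) : SB O (X0 n m b s A u j l) :=
  ((Pw_SB hA hu j l).mul' (cs_SB _ _ _ _)).add ((Qw_SB hA j l).mul' (cs_SB _ _ _ _))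
lemma Yw_ST (hA : SB O A) (hu : ∀ l, SB ∅ (u l)) : ST O (Yw n m b s A u) := by
  have hW := Ww_SB (n := n) (m := m) (b := b) (s := s) hA
  refine ⟨fun j l => ((((hu j).mul (hW l)).add ((hW j).mul' (hu l))).add ?_).add
    (((hW j).mul (hW l)).cmul _), fun j l q => by simp only [Yw]; ring⟩
  exact ((hA.mul' (cs_SB _ _ _ _)).cmul _).mul (((hW l).cmul _).add ((hW j).mulc _))
lemma f0_SB (hA : SB O A) (hu : ∀ l, SB ∅ (u l)) (l : Fin 3) : SB O (f0 m b s A u l) :=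
  (((((hA.D _).cmul _).sub ((ww_SB hA l).cmul _)).cmul _).add (dv_sb (Pw_SB hA hu) l)).sub
    (SB.sum _ fun j _ => ((Gw_SB hA hu).D _).cmul _)
lemma f1_SB (hA : SB O A) (l : Fin 3) : SB O (f1 b A l) := dv_sb (Qw_SB hA) l
lemma f2_SB (hA : SB O A) (l : Fin 3) : SB O (f2 m b A l) := ((ww_SB hA l).D _).cmul _

lemma Vw_eq (hA : SB O A) (hb : b m = 0) (hn : 1 ≤ n) (l : Fin 3) (q : STQ) : Vw n m b s A l q =
    r2 * (b l * A q * cs n m s 0 q) + 1 / Lam n * Ww n m b s A l q := by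
  have hL : Lam n ≠ 0 := by linarith [Lam_pos hn]
  unfold Vw dv Om Ww ww
  have : ∀ j, D (eX j) (fun q => (kap m b j l * r2 * (1 / Lam n)) * (A q * cs n m s (-(Real.pi / 2)) q)) q =
      r2 * (1 / Lam n) * cs n m s (-(Real.pi / 2)) q * (kap m b j l * D (eX j) A q) +
      dl j m * (kap m b j l * (r2 * A q * cs n m s 0 q)) := by
    intro j
    rw [(hA.mul' (cs_SB n m s (-(Real.pi / 2)))).D_cmul]
    simp only
    rw [DX_hcs hA, neg_add_cancel]
    field_simp
  simp only [this]
  rw [Finset.sum_add_distrib, sum_dl, ← Finset.mul_sum]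
  simp only [kap, hb, dl_self]
  ring

lemma Vw_div (hA : SB O A) (q : STQ) : ∑ l, D (eX l) (Vw n m b s A l) q = 0 := by
  have h1 : ∀ l, D (eX l) (Vw n m b s A l) q = ∑ j, D (eX l) (D (eX j) (Om n m b s A j l)) q := by
    intro l
    simp only [Vw]
    unfold dv
    rw [SB.D_sum _ fun j _ => (Om_SB hA j l).D _]
  have h2 : ∀ j l, D (eX l) (D (eX j) (Om n m b s A j l)) q = - D (eX j) (D (eX l) (Om n m b s A l j)) q := by
    intro j l
    have : Om n m b s A j l = fun q => (-1) * Om n m b s A l j q := by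
      funext q
      simp only [Om, kap]
      ring
    rw [this, (Om_SB hA l j).D_cmul, ((Om_SB hA l j).D _).D_cmul, (Om_SB hA l j).D_comm]
    simp
  simp only [h1]
  have h3 : ∑ l, ∑ j, D (eX l) (D (eX j) (Om n m b s A j l)) q =
      - ∑ l, ∑ j, D (eX l) (D (eX j) (Om n m b s A j l)) q := by
    conv_lhs => rw [Finset.sum_comm]
    rw [← Finset.sum_neg_distrib]
    refine Finset.sum_congr rfl fun l _ => ?_
    rw [← Finset.sum_neg_distrib]
    refine Finset.sum_congr rfl fun j _ => ?_
    exact h2 l j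
  linarith

lemma wave_tot (hA : SB O A) (hu : ∀ l, SB ∅ (u l)) (hb : b m = 0) (hn : 1 ≤ n) (l : Fin 3) (q : STQ) :
    D eT (Vw n m b s A l) q + dv (X0 n m b s A u) l q =
      dv (Tw n m b s A u) l q + ((f0 m b s A u l q * cs n m s 0 q + f1 b A l q * cs (2 * n) m s 0 q) +
        1 / Lam n * (f2 m b A l q * cs n m s (-(Real.pi / 2)) q)) := by
  have hL : Lam n ≠ 0 := by linarith [Lam_pos hn]
  have e1 : D eT (Vw n m b s A l) q = r2 * b l * (D eT A q * cs n m s 0 q + s * (Lam n * A q * cs n m s (-(Real.pi / 2)) q))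
      + (1 / Lam n) * (r2 * (D eT (ww m b A l) q * cs n m s (-(Real.pi / 2)) q - s * (Lam n * ww m b A l q * cs n m s 0 q))) := by
    have : Vw n m b s A l = fun q => (r2 * b l) * (A q * cs n m s 0 q) + (1 / Lam n) * Ww n m b s A l q := by
      funext q
      rw [Vw_eq hA hb hn]
      ring
    rw [this, ((hA.mul' (cs_SB n m s 0)).cmul _).D_add ((Ww_SB hA l).cmul _),
      (hA.mul' (cs_SB n m s 0)).D_cmul, (Ww_SB hA l).D_cmul]
    simp only
    rw [DT_hcs hA, cs_half]
    unfold Ww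
    rw [((ww_SB hA l).mul' (cs_SB n m s (-(Real.pi / 2)))).D_cmul]
    simp only
    rw [DT_hcs (ww_SB hA l), neg_add_cancel]
    ring
  have e2 : dv (X0 n m b s A u) l q = dv (Pw b A u) l q * cs n m s 0 q -
      Lam n * (r2 * (A q * u m q * b l)) * cs n m s (-(Real.pi / 2)) q + f1 b A l q * cs (2 * n) m s 0 q := by
    unfold f1 dv X0
    have : ∀ j, D (eX j) (fun q => Pw b A u j l q * cs n m s 0 q + Qw b A j l q * cs (2 * n) m s 0 q) q =
        (D (eX j) (Pw b A u j l) q * cs n m s 0 q + D (eX j) (Qw b A j l) q * cs (2 * n) m s 0 q) +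
        dl j m * (Lam n * Pw b A u j l q * cs n m s (0 + Real.pi / 2) q +
          Lam (2 * n) * Qw b A j l q * cs (2 * n) m s (0 + Real.pi / 2) q) := by
      intro j
      rw [((Pw_SB hA hu j l).mul' (cs_SB _ _ _ _)).D_add ((Qw_SB hA j l).mul' (cs_SB _ _ _ _))]
      simp only
      rw [DX_hcs (Pw_SB hA hu j l), DX_hcs (Qw_SB hA j l)]
      ring
    simp only [this]
    rw [Finset.sum_add_distrib, sum_dl, Finset.sum_add_distrib, ← Finset.sum_mul, ← Finset.sum_mul, cs_half]
    simp only [Pw, Qw, hb]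
    ring
  have e3 : dv (Tw n m b s A u) l q = (∑ j, Kap m b j l * D (eX j) (Gw m s A u) q) * cs n m s 0 q -
      Lam n * (b l * Gw m s A u q) * cs n m s (-(Real.pi / 2)) q := by
    unfold dv Tw
    have : ∀ j, D (eX j) (fun q => Kap m b j l * (Gw m s A u q * cs n m s 0 q)) q =
        Kap m b j l * D (eX j) (Gw m s A u) q * cs n m s 0 q +
        dl j m * (Kap m b j l * (Lam n * Gw m s A u q * cs n m s (0 + Real.pi / 2) q)) := by
      intro j
      rw [((Gw_SB hA hu).mul' (cs_SB n m s 0)).D_cmul]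
      simp only
      rw [DX_hcs (Gw_SB hA hu)]
      ring
    simp only [this]
    rw [Finset.sum_add_distrib, sum_dl, ← Finset.sum_mul, cs_half]
    simp only [Kap, hb, dl_self]
    ring
  rw [e1, e2, e3]
  simp only [f0, f2, Gw]
  field_simp
  ring

lemma wave_X (hA : SB O A) (hb : b m = 0) (hn : 1 ≤ n) (j l : Fin 3) (q : STQ) :
    u j q * Vw n m b s A l q + Vw n m b s A j q * u l q + Vw n m b s A j q * Vw n m b s A l q =
      X0 n m b s A u j l q + 1 / Lam n * Yw n m b s A u j l q + A q * A q * (b j * b l) := by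
  have h1 := r2_sq
  have h2 := cs_sq n m s q
  have h3 : cs (2 * n) m s 0 q = r2 * r2 * (cs n m s 0 q * cs n m s 0 q) - 1 := by rw [h1, h2]; ring
  rw [Vw_eq hA hb hn, Vw_eq hA hb hn]
  simp only [X0, Yw, Pw, Qw, h3]
  ring

end wave

end CI

namespace CI
open Set Filter Topology

variable {O : Set ℝ} {f g : STQ → ℝ}

lemma mn_cmul (i : Fin 3) (c : ℝ) : mn i (fun q => c * f q) = fun q => c * mn i f q := by
  funext q
  simp only [mn, Kop, one_mul]
  rw [intervalIntegral.integral_const_mul]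

lemma Mn_cmul (c : ℝ) : Mn (fun q => c * f q) = fun q => c * Mn f q := by
  simp only [Mn, mn_cmul]

structure Inc (O : Set ℝ) (v V : Fin 3 → STQ → ℝ) (B E : Fin 3 → Fin 3 → STQ → ℝ) (η : ℝ) : Prop where
  gV : ∀ l, Good O (V l)
  gE : ∀ j l, Good O (E j l)
  sE : ∀ j l q, E j l q = E l j q
  wer : ∀ p R, Continuous p → (∀ j l, Continuous (R j l)) → WER v p R →
    WER (fun l q => v l q + V l q) p (fun j l q => R j l q + B j l q + E j l q)
  en : ∀ t, |J (fun q => ∑ i, ((v i q + V i q) ^ 2 - v i q ^ 2 - B i i q)) t| ≤ η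

lemma Inc.comp {v V V' : Fin 3 → STQ → ℝ} {B E B' E' : Fin 3 → Fin 3 → STQ → ℝ} {η η' : ℝ}
    (h : Inc O v V B E η) (h' : Inc O (fun l q => v l q + V l q) V' B' E' η')
    (cv : ∀ l, Continuous (v l)) (cB : ∀ j l, Continuous (B j l)) (cB' : ∀ j l, Continuous (B' j l)) :
    Inc O v (fun l q => V l q + V' l q) (fun j l q => B j l q + B' j l q) (fun j l q => E j l q + E' j l q)
      (η + η') := by
  refine ⟨fun l => (h.gV l).add (h'.gV l), fun j l => (h.gE j l).add (h'.gE j l),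
    fun j l q => by rw [h.sE, h'.sE], fun p R cp cR hw => ?_, fun t => ?_⟩
  · have h1 := h.wer p R cp cR hw
    have h2 := h'.wer p _ cp (fun j l => ((cR j l).add (cB j l)).add (h.gE j l).cont) h1
    exact h2.congr (fun j q => by ring) (fun q => rfl) (fun j l q => by simp only [Pi.add_apply]; ring)
  · have c := fun l => (h.gV l).cont
    have c' := fun l => (h'.gV l).cont
    have e : (fun q => ∑ i, ((v i q + (V i q + V' i q)) ^ 2 - v i q ^ 2 - (B i i q + B' i i q))) =
        fun q => (∑ i, ((v i q + V i q) ^ 2 - v i q ^ 2 - B i i q)) +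
          ∑ i, (((v i q + V i q) + V' i q) ^ 2 - (v i q + V i q) ^ 2 - B' i i q) := by
      funext q
      rw [← Finset.sum_add_distrib]
      refine Finset.sum_congr rfl fun i _ => ?_
      ring
    rw [e, J_add (by fun_prop) (by fun_prop)]
    exact (abs_add_le _ _).trans (add_le_add (h.en t) (h'.en t))

lemma Inc.congr {v V V' : Fin 3 → STQ → ℝ} {B E B' E' : Fin 3 → Fin 3 → STQ → ℝ} {η η' : ℝ}
    (h : Inc O v V B E η) (h1 : ∀ l q, V l q = V' l q) (h2 : ∀ j l q, B j l q = B' j l q)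
    (h3 : ∀ j l q, E j l q = E' j l q) (h4 : η ≤ η') : Inc O v V' B' E' η' := by
  have e1 : V = V' := funext fun j => funext fun q => h1 j q
  have e2 : B = B' := funext fun j => funext fun l => funext fun q => h2 j l q
  have e3 : E = E' := funext fun j => funext fun l => funext fun q => h3 j l q
  subst e1 e2 e3
  exact ⟨h.gV, h.gE, h.sE, h.wer, fun t => (h.en t).trans h4⟩

lemma Inc.zero (v : Fin 3 → STQ → ℝ) : Inc O v (fun _ _ => 0) (fun _ _ _ => 0) (fun _ _ _ => 0) 0 := by
  refine ⟨fun _ => Good.zero, fun _ _ => Good.zero, fun _ _ _ => rfl, fun p R _ _ hw => ?_, fun t => ?_⟩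
  · simpa using hw
  · simp [J]

section
variable {n : ℕ} {m : Fin 3} {b : Fin 3 → ℝ} {s : ℝ} {A : STQ → ℝ} {u : Fin 3 → STQ → ℝ}

lemma wave_mean (hA : SB O A) (hu : ∀ l, SB ∅ (u l)) (hb : b m = 0) (hn : 1 ≤ n) (l : Fin 3) (q : STQ) :
    Mn (fun q => f0 m b s A u l q * cs n m s 0 q) q + Mn (fun q => f1 b A l q * cs (2 * n) m s 0 q) q +
      1 / Lam n * Mn (fun q => f2 m b A l q * cs n m s (-(Real.pi / 2)) q) q = 0 := by
  have s0 := (f0_SB (s := s) (m := m) (b := b) hA hu l).mul' (cs_SB n m s 0)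
  have s1 := (f1_SB (b := b) hA l).mul' (cs_SB (2 * n) m s 0)
  have s2 := (f2_SB (m := m) (b := b) hA l).mul' (cs_SB n m s (-(Real.pi / 2)))
  have sV := (Vw_SB (n := n) (m := m) (b := b) (s := s) hA l)
  have sX := X0_SB (n := n) (m := m) (b := b) (s := s) hA hu
  have sT := (Tw_ST (n := n) (m := m) (b := b) (s := s) hA hu).sb
  have e : Mn (fun q => D eT (Vw n m b s A l) q + dv (X0 n m b s A u) l q) = Mn (fun q =>
      dv (Tw n m b s A u) l q + ((f0 m b s A u l q * cs n m s 0 q + f1 b A l q * cs (2 * n) m s 0 q) +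
        1 / Lam n * (f2 m b A l q * cs n m s (-(Real.pi / 2)) q))) := by
    congr 1
    funext q
    exact wave_tot hA hu hb hn l q
  rw [Mn_add (sV.D _) (dv_sb sX l), Mn_add (dv_sb sT l) ((s0.add s1).add (s2.cmul _)), Mn_add (s0.add s1) (s2.cmul _),
    Mn_add s0 s1, Mn_cmul, Mn_dv sX, Mn_dv sT, ← Mn_D sV] at e
  have h0 : Mn (Vw n m b s A l) = fun _ => 0 := Mn_dv (Om_SB hA) l
  rw [h0, D_const] at e
  have := congrFun e q
  simp only at this
  linarith
end

lemma vec_bdd' {h : Fin 3 → STQ → ℝ} (hh : ∀ j, Good O (h j)) :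
    ∃ C, 0 ≤ C ∧ ∀ j q, |h j q| ≤ C := by
  choose C hC using fun j => (hh j).bdd
  have h0 : ∀ j, 0 ≤ C j := fun j => (abs_nonneg _).trans (hC j 0)
  refine ⟨∑ j, C j, Finset.sum_nonneg fun j _ => h0 j, fun j q => (hC j q).trans ?_⟩
  exact Finset.single_le_sum (f := C) (fun j _ => h0 j) (Finset.mem_univ j)

lemma step {v : Fin 3 → STQ → ℝ} (hv : ∀ l, Good ∅ (v l)) {m : Fin 3} {b : Fin 3 → ℝ} (hb : b m = 0)
    (hb1 : ∀ i, |b i| ≤ 1) {s δ : ℝ} (hδ : 0 ≤ δ) {A : STQ → ℝ} (hA : SB O A)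
    (hs : ∀ q, A q ≠ 0 → |v m q - s| ≤ δ) {η : ℝ} (hη : 0 < η) :
    ∃ V E, Inc O v V (fun j l q => A q * A q * (b j * b l)) E η ∧ (∀ l q, |V l q| ≤ 2 * |A q| + η) ∧
      (∀ q, |V m q| ≤ η) ∧ (∀ j l q, |E j l q| ≤ 3 * δ * |A q| + η) := by
  obtain ⟨CA, hCA⟩ := hA.bas.bdd
  have CA0 : 0 ≤ CA := (abs_nonneg _).trans (hCA 0)
  set μ : ℝ := η / (24 * (2 * CA + 1)) with hμ
  have μ0 : 0 < μ := by positivity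
  have μe : μ * (2 * CA + 1) = η / 24 := by rw [hμ]; field_simp
  choose u hu huv using fun l => moll (hv l) μ0
  obtain ⟨Cu, Cu0, hCu⟩ := vec_bdd hu
  obtain ⟨Cw, Cw0, hCw⟩ := vec_bdd (ww_SB (m := m) (b := b) hA)
  obtain ⟨Ca, Ca0, hCa⟩ := osc m s (f0_SB (s := s) (m := m) (b := b) hA hu)
  obtain ⟨Cb, Cb0, hCb⟩ := osc m s (f1_SB (b := b) hA)
  obtain ⟨Cc, Cc0, hCc⟩ := osc m s (f2_SB (m := m) (b := b) hA)
  obtain ⟨Cd, Cd0, hCd⟩ := J_osc (SB.sum Finset.univ fun i _ => Pw_SB (b := b) hA hu i i) m s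
  obtain ⟨Ce, Ce0, hCe⟩ := J_osc (SB.sum Finset.univ fun i _ => Qw_SB (b := b) hA i i) m s
  set CW : ℝ := 2 * Cw with hCW
  have CW0 : 0 ≤ CW := by positivity
  set CY : ℝ := 2 * Cu * CW + 3 * CA * CW + CW * CW with hCY
  have CY0 : 0 ≤ CY := by positivity
  set Z : ℝ := CW + 3 * CY + Ca + Cb + Cc + Cd + Ce with hZ
  have Z0 : 0 ≤ Z := by positivity
  obtain ⟨n, hn⟩ := exists_nat_gt (max (Z / (min (η / 4) 1)) 1)
  have hmin : 0 < min (η / 4) 1 := lt_min (by positivity) one_pos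
  have hn1 : (1:ℝ) < n := (le_max_right _ _).trans_lt hn
  have hn0 : (0:ℝ) < n := by linarith
  have hn1' : 1 ≤ n := by exact_mod_cast hn1.le
  have hZn : Z / n ≤ min (η / 4) 1 := by
    have := (le_max_left _ _).trans_lt hn
    rw [div_lt_iff₀ hmin] at this
    rw [div_le_iff₀ hn0]
    linarith
  have hZ1 : Z * (1 / n) ≤ η / 4 := by
    rw [mul_one_div]; exact hZn.trans (min_le_left _ _)
  have hZ2 : Z * (1 / n) ≤ 1 := by
    rw [mul_one_div]; exact hZn.trans (min_le_right _ _)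
  have hi0 : 0 < 1 / (n:ℝ) := by positivity
  obtain ⟨hL1, hL2⟩ := Lam_pos hn1'
  have hL0 : 0 < Lam n := by linarith
  have hLn : 1 / Lam n ≤ 1 / n := one_div_le_one_div_of_le hn0 hL1
  have hLi : 0 ≤ 1 / Lam n := by positivity
  have hLi1 : 1 / Lam n ≤ 1 := by rw [div_le_one hL0]; exact hL2
  -- the pieces
  obtain ⟨Sa, sta, ba, da⟩ := hCa n hn1' 0
  obtain ⟨Sb, stb, bb, db⟩ := hCb (2 * n) (by omega) 0
  obtain ⟨Sc, stc, bc, dc⟩ := hCc n hn1' (-(Real.pi / 2))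
  have bb' : ∀ j k q, |Sb j k q| ≤ Cb * (1 / n) := by
    intro j k q
    refine (bb j k q).trans ?_
    rw [mul_one_div]
    push_cast
    gcongr
    linarith
  have ba' : ∀ j k q, |Sa j k q| ≤ Ca * (1 / n) := by simpa only [mul_one_div] using ba
  have bc' : ∀ j k q, |1 / Lam n * Sc j k q| ≤ Cc * (1 / n) := by
    intro j k q
    rw [abs_mul, abs_of_nonneg hLi, mul_one_div]
    calc _ ≤ 1 * |Sc j k q| := by gcongr
      _ ≤ _ := by rw [one_mul]; exact bc j k q
  set V := Vw n m b s A with hV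
  set X0' := X0 n m b s A u with hX0
  set Y := Yw n m b s A u with hY
  set T := Tw n m b s A u with hT
  set W := Ww n m b s A with hW
  have sV : ∀ l, SB O (V l) := Vw_SB hA
  have sX : ∀ j l, SB O (X0' j l) := X0_SB hA hu
  have sY : ST O Y := Yw_ST hA hu
  have sT : ST O T := Tw_ST hA hu
  -- bounds
  have bW : ∀ l q, |W l q| ≤ CW := by
    intro l q
    simp only [hW, Ww]
    rw [abs_mul, abs_mul, abs_of_nonneg r2_pos]
    have := r2_le
    have := hCw l q
    have := cs_abs n m s (-(Real.pi / 2)) q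
    calc r2 * (|ww m b A l q| * |cs n m s (-(Real.pi / 2)) q|) ≤ (3 / 2) * (Cw * 1) := by gcongr
      _ ≤ CW := by rw [hCW]; linarith
  have bLW : ∀ l q, |1 / Lam n * W l q| ≤ CW * (1 / n) := by
    intro l q
    rw [abs_mul, abs_of_nonneg hLi, mul_comm]
    gcongr
    exact bW l q
  have hcw : CW * (1 / n) ≤ Z * (1 / n) := by
    refine mul_le_mul_of_nonneg_right ?_ hi0.le
    rw [hZ]; linarith
  have bac : ∀ q, |r2 * (A q * cs n m s 0 q)| ≤ 3 / 2 * |A q| := by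
    intro q
    rw [abs_mul, abs_mul, abs_of_nonneg r2_pos]
    have := r2_le
    have := cs_abs n m s 0 q
    calc _ ≤ 3 / 2 * (|A q| * 1) := by gcongr
      _ = _ := by ring
  have bV : ∀ l q, |V l q| ≤ 3 / 2 * |A q| + CW * (1 / n) := by
    intro l q
    rw [hV, Vw_eq hA hb hn1']
    refine (abs_add_le _ _).trans (add_le_add ?_ (bLW l q))
    rw [show r2 * (b l * A q * cs n m s 0 q) = b l * (r2 * (A q * cs n m s 0 q)) by ring, abs_mul]
    calc _ ≤ 1 * (3 / 2 * |A q|) := by gcongr; exact hb1 l; exact bac q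
      _ = _ := one_mul _
  have bV1 : ∀ l q, |V l q| ≤ 2 * CA + 1 := by
    intro l q
    linarith [bV l q, hCA q]
  have bY : ∀ j l q, |1 / Lam n * Y j l q| ≤ CY * (1 / n) := by
    intro j l q
    rw [abs_mul, abs_of_nonneg hLi, mul_comm]
    refine mul_le_mul ?_ hLn hLi CY0
    simp only [hY, Yw]
    rw [← hW]
    have k1 : |u j q * W l q| ≤ Cu * CW := by
      rw [abs_mul]; gcongr; exact hCu j q; exact bW l q
    have k2 : |W j q * u l q| ≤ Cu * CW := by
      rw [abs_mul, mul_comm]; gcongr; exact hCu l q; exact bW j q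
    have k3 : |b j * W l q + W j q * b l| ≤ CW + CW := by
      refine (abs_add_le _ _).trans (add_le_add ?_ ?_)
      · rw [abs_mul]
        calc _ ≤ 1 * CW := by gcongr; exact hb1 j; exact bW l q
          _ = _ := one_mul _
      · rw [abs_mul]
        calc _ ≤ CW * 1 := by gcongr; exact bW j q; exact hb1 l
          _ = _ := mul_one _
    have k4 : |r2 * (A q * cs n m s 0 q) * (b j * W l q + W j q * b l)| ≤ 3 / 2 * CA * (CW + CW) := by
      rw [abs_mul]
      have : |r2 * (A q * cs n m s 0 q)| ≤ 3 / 2 * CA := by linarith [bac q, hCA q]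
      gcongr
    have k5 : |1 / Lam n * (W j q * W l q)| ≤ CW * CW := by
      rw [abs_mul, abs_of_nonneg hLi, abs_mul]
      calc _ ≤ 1 * (CW * CW) := by gcongr; exact bW j q; exact bW l q
        _ = _ := one_mul _
    refine (abs_add_le _ _).trans ?_
    have := (abs_add_three (u j q * W l q) (W j q * u l q) (r2 * (A q * cs n m s 0 q) * (b j * W l q + W j q * b l)))
    rw [hCY]
    linarith
  have bT : ∀ j l q, |T j l q| ≤ 3 * δ * |A q| + η / 4 := by
    intro j l q
    have hK : |Kap m b j l| ≤ 2 := by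
      unfold Kap
      refine (abs_add_le _ _).trans ?_
      rw [abs_mul, abs_mul]
      have := mul_le_mul (dl_abs j m) (hb1 l) (abs_nonneg _) zero_le_one
      have := mul_le_mul (hb1 j) (dl_abs l m) (abs_nonneg _) zero_le_one
      linarith
    have hG : |(u m q - s) * A q| ≤ (δ + μ) * |A q| := by
      rw [abs_mul]
      by_cases h0 : A q = 0
      · simp [h0]
      · gcongr
        calc |u m q - s| = |(u m q - v m q) + (v m q - s)| := by ring_nf
          _ ≤ _ := (abs_add_le _ _).trans (by linarith [huv m q, hs q h0])
    have hP : 0 ≤ (δ + μ) * |A q| := by positivity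
    simp only [hT, Tw, Gw]
    rw [abs_mul, abs_mul, abs_mul, abs_of_nonneg r2_pos]
    have := r2_le
    have := r2_pos
    have := cs_abs n m s 0 q
    calc |Kap m b j l| * (r2 * |(u m q - s) * A q| * |cs n m s 0 q|)
        ≤ 2 * ((3 / 2) * ((δ + μ) * |A q|) * 1) := by gcongr
      _ = 3 * δ * |A q| + 3 * (μ * |A q|) := by ring
      _ ≤ _ := by
        have : μ * |A q| ≤ μ * (2 * CA + 1) := by
          gcongr; linarith [hCA q]
        linarith
  set F : Fin 3 → Fin 3 → STQ → ℝ := fun j l q => (v j q - u j q) * V l q + V j q * (v l q - u l q) with hF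
  have bvu : ∀ j q, |v j q - u j q| ≤ μ := fun j q => by rw [abs_sub_comm]; exact huv j q
  have bvV : ∀ j l q, |(v j q - u j q) * V l q| ≤ η / 24 := by
    intro j l q
    rw [abs_mul, ← μe]
    gcongr
    exact bvu j q
    exact bV1 l q
  have bF : ∀ j l q, |F j l q| ≤ η / 4 := by
    intro j l q
    refine (abs_add_le _ _).trans ?_
    have h1 := bvV j l q
    have h2 := bvV l j q
    rw [mul_comm] at h2
    linarith
  have gvu : ∀ j, Good ∅ (fun q => v j q - u j q) := fun j => (hv j).sub (hu j).good
  have gF : ∀ j l, Good O (F j l) := fun j l => ((gvu j).mul (sV l).good).add ((sV j).good.mul' (gvu l))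
  have stS : ST O (fun j l q => (T j l q + (Sa j l q + Sb j l q)) + (1 / Lam n * Sc j l q + 1 / Lam n * Y j l q)) :=
    (sT.add (sta.add stb)).add ((stc.cmul _).add (sY.cmul _))
  refine ⟨V, fun j l q => F j l q + ((T j l q + (Sa j l q + Sb j l q)) + (1 / Lam n * Sc j l q + 1 / Lam n * Y j l q)),
    ⟨fun l => (sV l).good, fun j l => (gF j l).add (stS.sb j l).good, fun j l q => ?_, fun p R cp cR hw => ?_,
      fun t => ?_⟩, fun l q => ?_, fun q => ?_, fun j l q => ?_⟩
  · have := stS.symm j l q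
    simp only [hF]
    rw [this]
    ring
  · have hup := hw.update (fun j => (hv j).cont) cp cR sV
      (X := fun j l q => X0' j l q + 1 / Lam n * Y j l q)
      (N := fun j l q => A q * A q * (b j * b l) + F j l q)
      (fun j l => (sX j l).add ((sY.sb j l).cmul _)) stS.sb ?_ (Vw_div hA) ?_
    · exact hup.congr (fun _ _ => rfl) (fun _ => rfl) (fun j l q => by ring)
    · intro l q
      rw [dv_add sX (sY.cmul _).sb, dv_add (sT.add (sta.add stb)).sb ((stc.cmul _).add (sY.cmul _)).sb,
        dv_add sT.sb (sta.add stb).sb, dv_add sta.sb stb.sb, dv_add (stc.cmul _).sb (sY.cmul _).sb,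
        dv_cmul stc.sb, dv_cmul sY.sb, da, db, dc]
      have h1 := wave_tot (n := n) (s := s) hA hu hb hn1' l q
      have h2 := wave_mean (n := n) (s := s) hA hu hb hn1' l q
      rw [← hV, ← hX0, ← hT] at h1
      linarith
    · intro j l q
      have h1 := wave_X (n := n) (s := s) (u := u) hA hb hn1' j l q
      rw [← hV, ← hX0, ← hY] at h1
      simp only [hF]
      linarith
  · have cu : ∀ j, Continuous (fun q => v j q - u j q) := fun j => (gvu j).cont
    have cV : ∀ j, Continuous (V j) := fun j => (sV j).cont
    have sPP := (SB.sum Finset.univ fun i _ => Pw_SB (b := b) hA hu i i)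
    have sQQ := (SB.sum Finset.univ fun i _ => Qw_SB (b := b) hA i i)
    have c1 := (sPP.mul' (cs_SB n m s 0)).cont
    have c2 := (sQQ.mul' (cs_SB (2 * n) m s 0)).cont
    have c3 : Continuous (fun q => ∑ i, (2 * ((v i q - u i q) * V i q) + 1 / Lam n * Y i i q)) :=
      continuous_finsetSum _ fun i _ => (continuous_const.mul ((cu i).mul (cV i))).add ((sY.sb i i).cmul _).cont
    have e : (fun q => ∑ i, ((v i q + V i q) ^ 2 - v i q ^ 2 - A q * A q * (b i * b i))) =
        fun q => (((∑ i, Pw b A u i i q) * cs n m s 0 q) + ((∑ i, Qw b A i i q) * cs (2 * n) m s 0 q)) +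
          ∑ i, (2 * ((v i q - u i q) * V i q) + 1 / Lam n * Y i i q) := by
      funext q
      rw [Finset.sum_mul, Finset.sum_mul, ← Finset.sum_add_distrib, ← Finset.sum_add_distrib]
      refine Finset.sum_congr rfl fun i _ => ?_
      have h1 := wave_X (n := n) (s := s) (u := u) hA hb hn1' i i q
      rw [← hV, ← hY] at h1
      simp only [X0] at h1
      linarith
    have c12 : Continuous (fun q => ((∑ i, Pw b A u i i q) * cs n m s 0 q) +
        ((∑ i, Qw b A i i q) * cs (2 * n) m s 0 q)) := c1.add c2
    rw [e, J_add c12 c3, J_add c1 c2]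
    have e1 := hCd n hn1' 0 t
    have e2 := hCe (2 * n) (by omega) 0 t
    have e3 : |J (fun q => ∑ i, (2 * ((v i q - u i q) * V i q) + 1 / Lam n * Y i i q)) t| ≤
        η / 4 + 3 * CY * (1 / n) := by
      refine J_bound (fun q => ?_) t
      refine (Finset.abs_sum_le_sum_abs _ _).trans ?_
      have : ∀ i ∈ Finset.univ, |2 * ((v i q - u i q) * V i q) + 1 / Lam n * Y i i q| ≤ η / 12 + CY * (1 / n) := by
        intro i _
        refine (abs_add_le _ _).trans (add_le_add ?_ (bY i i q))
        rw [abs_mul, abs_of_nonneg (by norm_num : (0:ℝ) ≤ 2)]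
        linarith [bvV i i q]
      refine (Finset.sum_le_sum this).trans ?_
      simp
      linarith
    have e2' : Ce / ((2 * n : ℕ) : ℝ) ≤ Ce * (1 / n) := by
      rw [mul_one_div]
      push_cast
      gcongr
      linarith
    have e1' : Cd / n = Cd * (1 / n) := by ring
    refine (abs_add_le _ _).trans ?_
    have e4 := abs_add_le (J (fun q => (∑ i, Pw b A u i i q) * cs n m s 0 q) t)
      (J (fun q => (∑ i, Qw b A i i q) * cs (2 * n) m s 0 q) t)
    have : (Cd + Ce + 3 * CY) * (1 / n) ≤ Z * (1 / n) := by
      refine mul_le_mul_of_nonneg_right ?_ hi0.le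
      rw [hZ]; linarith
    linarith
  · have := abs_nonneg (A q)
    linarith [bV l q]
  · rw [hV, Vw_eq hA hb hn1', hb]
    have := bLW m q
    simp only [zero_mul, mul_zero, zero_add]
    linarith
  · have : (Ca + Cb + Cc + CY) * (1 / n) ≤ Z * (1 / n) := by
      refine mul_le_mul_of_nonneg_right ?_ hi0.le
      rw [hZ]; linarith
    have h1 := abs_add_le (F j l q) ((T j l q + (Sa j l q + Sb j l q)) + (1 / Lam n * Sc j l q + 1 / Lam n * Y j l q))
    have h2 := abs_add_le (T j l q + (Sa j l q + Sb j l q)) (1 / Lam n * Sc j l q + 1 / Lam n * Y j l q)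
    have h3 := abs_add_le (T j l q) (Sa j l q + Sb j l q)
    have h4 := abs_add_le (Sa j l q) (Sb j l q)
    have h5 := abs_add_le (1 / Lam n * Sc j l q) (1 / Lam n * Y j l q)
    linarith [bF j l q, bT j l q, ba' j l q, bb' j l q, bc' j l q, bY j l q]

end CI

namespace CI
open Set Filter Topology

variable {O : Set ℝ} {f g : STQ → ℝ}

lemma fold {v : Fin 3 → STQ → ℝ} (hv : ∀ l, Good ∅ (v l)) {m : Fin 3} {b : Fin 3 → ℝ} (hb : b m = 0)
    (hb1 : ∀ i, |b i| ≤ 1) {s : ℕ → ℝ} {δ : ℝ} (hδ : 0 ≤ δ) {A : ℕ → STQ → ℝ} (hA : ∀ k, SB O (A k))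
    (hs : ∀ k q, A k q ≠ 0 → |v m q - s k| ≤ δ) {η : ℝ} (hη : 0 < η) (N : ℕ) (hN : N * η ≤ δ) :
    ∀ n ≤ N, ∃ V E, Inc O v V (fun j l q => (∑ k ∈ Finset.range n, A k q * A k q) * (b j * b l)) E (n * η) ∧
      (∀ l q, |V l q| ≤ 2 * (∑ k ∈ Finset.range n, |A k q|) + n * η) ∧
      (∀ q, |V m q| ≤ n * η) ∧
      (∀ j l q, |E j l q| ≤ 6 * δ * (∑ k ∈ Finset.range n, |A k q|) + n * η) := by
  intro n
  induction n with
  | zero =>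
    intro _
    refine ⟨fun _ _ => 0, fun _ _ _ => 0, ?_, by simp, by simp, by simp⟩
    exact (Inc.zero v).congr (fun _ _ => rfl) (by simp) (fun _ _ _ => rfl) (by simp)
  | succ n ih =>
    intro hn
    obtain ⟨V, E, hI, hV, hVm, hE⟩ := ih (by omega)
    have hnN : (n:ℝ) * η ≤ δ := by
      refine le_trans ?_ hN
      gcongr
      omega
    have hv' : ∀ l, Good ∅ (fun q => v l q + V l q) := fun l => (hv l).add (hI.gV l).e
    obtain ⟨V', E', hI', hV', hVm', hE'⟩ := step hv' hb hb1 (s := s n) (δ := 2 * δ) (by linarith) (hA n)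
      (fun q hq => by
        have := hs n q hq
        have := hVm q
        calc |v m q + V m q - s n| = |(v m q - s n) + V m q| := by ring_nf
          _ ≤ _ := (abs_add_le _ _).trans (by linarith)) hη
    have cA : ∀ k, Continuous (A k) := fun k => (hA k).cont
    refine ⟨_, _, (hI.comp hI' (fun l => (hv l).cont) ?_ ?_).congr (fun _ _ => rfl) ?_ (fun _ _ _ => rfl) ?_, ?_, ?_, ?_⟩
    · intro j l; fun_prop
    · intro j l; fun_prop
    · intro j l q; rw [Finset.sum_range_succ]; ring
    · push_cast; linarith
    · intro l q
      rw [Finset.sum_range_succ]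
      push_cast
      linarith [abs_add_le (V l q) (V' l q), hV l q, hV' l q]
    · intro q
      push_cast
      linarith [abs_add_le (V m q) (V' m q), hVm q, hVm' q]
    · intro j l q
      rw [Finset.sum_range_succ]
      push_cast
      linarith [abs_add_le (E j l q) (E' j l q), hE j l q, hE' j l q]

def ths (k : ℕ) (w : ℝ) : ℝ := Real.sin (Real.pi / 2 * Real.smoothTransition (w - k))
def thc (k : ℕ) (w : ℝ) : ℝ := Real.cos (Real.pi / 2 * Real.smoothTransition (w - k))
def chi (k : ℕ) (w : ℝ) : ℝ := ths k w * thc (k + 1) w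

lemma ths_zero {k : ℕ} {w : ℝ} (h : w ≤ k) : ths k w = 0 := by
  simp [ths, Real.smoothTransition.zero_of_nonpos (sub_nonpos.2 h)]
lemma ths_one {k : ℕ} {w : ℝ} (h : k + 1 ≤ w) : ths k w = 1 := by
  simp [ths, Real.smoothTransition.one_of_one_le (by linarith : 1 ≤ w - k)]
lemma thc_zero {k : ℕ} {w : ℝ} (h : k + 1 ≤ w) : thc k w = 0 := by
  simp [thc, Real.smoothTransition.one_of_one_le (by linarith : 1 ≤ w - k)]

lemma chi_smooth (k : ℕ) : ContDiff ℝ (⊤ : ℕ∞) (chi k) := by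
  unfold chi ths thc
  have h : ∀ k : ℕ, ContDiff ℝ (⊤ : ℕ∞) (fun w : ℝ => Real.pi / 2 * Real.smoothTransition (w - k)) := fun k =>
    contDiff_const.mul (Real.smoothTransition.contDiff.comp (contDiff_id.sub contDiff_const))
  exact (Real.contDiff_sin.comp (h k)).mul (Real.contDiff_cos.comp (h (k + 1)))

lemma chi_sq (k : ℕ) (w : ℝ) : chi k w * chi k w = ths k w ^ 2 - ths (k + 1) w ^ 2 := by
  have h : thc (k + 1) w ^ 2 = 1 - ths (k + 1) w ^ 2 := by
    have := Real.sin_sq_add_cos_sq (Real.pi / 2 * Real.smoothTransition (w - ((k + 1 : ℕ) : ℝ)))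
    simp only [ths, thc]; linarith
  rcases le_total w (k + 1) with hw | hw
  · have := ths_zero (k := k + 1) (w := w) (by push_cast; exact hw)
    rw [this] at h
    simp only [chi, this]
    linear_combination (ths k w) ^ 2 * h
  · rw [chi, ths_one hw]
    linear_combination h

lemma chi_sum (N : ℕ) (w : ℝ) (h1 : 1 ≤ w) (h2 : w ≤ N) : ∑ k ∈ Finset.range N, chi k w * chi k w = 1 := by
  simp only [chi_sq]
  rw [Finset.sum_range_sub' (fun k => ths k w ^ 2), ths_zero h2, ths_one (k := 0) (by simpa using h1)]
  norm_num

lemma chi_supp {k : ℕ} {w : ℝ} (h : chi k w ≠ 0) : k < w ∧ w < k + 2 := by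
  constructor
  · by_contra hc
    exact h (by rw [chi, ths_zero (not_lt.1 hc), zero_mul])
  · by_contra hc
    exact h (by rw [chi, thc_zero (by push_cast; linarith), mul_zero])

lemma chi_le (k : ℕ) (w : ℝ) : |chi k w| ≤ 1 := by
  rw [chi, abs_mul]
  exact mul_le_one₀ (Real.abs_sin_le_one _) (abs_nonneg _) (Real.abs_cos_le_one _)

lemma chi_abs_sum (N : ℕ) (w : ℝ) : ∑ k ∈ Finset.range N, |chi k w| ≤ 2 := by
  have : ∀ k ∈ Finset.range N, |chi k w| ≤ (if k = ⌊w⌋₊ then 1 else 0) + (if k = ⌊w⌋₊ - 1 then 1 else 0) := by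
    intro k _
    by_cases h : chi k w = 0
    · rw [h, abs_zero]; positivity
    · obtain ⟨h1, h2⟩ := chi_supp h
      have hw : 0 ≤ w := (Nat.cast_nonneg k).trans h1.le
      have h3 : k ≤ ⌊w⌋₊ := Nat.le_floor h1.le
      have h4 : ⌊w⌋₊ < k + 2 := (Nat.floor_lt hw).2 (by push_cast; exact h2)
      have h5 := chi_le k w
      by_cases h6 : k = ⌊w⌋₊
      · rw [if_pos h6]
        split_ifs <;> linarith
      · rw [if_neg h6, if_pos (by omega)]; linarith
  refine (Finset.sum_le_sum this).trans ?_
  rw [Finset.sum_add_distrib, Finset.sum_ite_eq', Finset.sum_ite_eq']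
  split_ifs <;> norm_num

lemma direction {v : Fin 3 → STQ → ℝ} (hv : ∀ l, Good ∅ (v l)) {m : Fin 3} {b : Fin 3 → ℝ} (hb : b m = 0)
    (hb1 : ∀ i, |b i| ≤ 1) {a : STQ → ℝ} (ha : SB O a) {η : ℝ} (hη : 0 < η) :
    ∃ V E, Inc O v V (fun j l q => a q * a q * (b j * b l)) E η ∧
      (∀ l q, |V l q| ≤ 4 * |a q| + η) ∧ (∀ j l q, |E j l q| ≤ η) := by
  obtain ⟨Ca, hCa⟩ := ha.bas.bdd
  have Ca0 : 0 ≤ Ca := (abs_nonneg _).trans (hCa 0)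
  set δ : ℝ := η / (48 * (Ca + 1)) with hδ
  have δ0 : 0 < δ := by positivity
  have δe : 48 * (δ * (Ca + 1)) = η := by rw [hδ]; field_simp
  obtain ⟨u, hu, huv⟩ := moll (hv m) δ0
  obtain ⟨Cu, hCu⟩ := hu.bas.bdd
  have Cu0 : 0 ≤ Cu := (abs_nonneg _).trans (hCu 0)
  obtain ⟨M, hM⟩ := exists_nat_gt (Cu / δ + 1)
  set w : STQ → ℝ := fun q => 1 / δ * u q + M with hw
  have sw : SB ∅ w := (hu.cmul _).add (SB.const _)
  have hwb : ∀ q, 1 ≤ w q ∧ w q ≤ (2 * M : ℕ) := by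
    intro q
    have h1 : |1 / δ * u q| ≤ Cu / δ := by
      rw [abs_mul, abs_of_pos (by positivity : 0 < 1 / δ), one_div_mul_eq_div]
      gcongr
      exact hCu q
    rw [abs_le] at h1
    simp only [hw]
    push_cast
    constructor <;> linarith
  set N := 2 * M with hNM
  set A : ℕ → STQ → ℝ := fun k q => chi k (w q) * a q with hA
  have sA : ∀ k, SB O (A k) := fun k => (SB.comp (chi_smooth k) sw).mul ha
  set η' : ℝ := min (η / 2) δ / (N + 1) with hη'
  have hmin : 0 < min (η / 2) δ := lt_min (by positivity) δ0
  have η'0 : 0 < η' := by positivity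
  have hNη : N * η' ≤ min (η / 2) δ := by
    rw [hη', mul_div_assoc', div_le_iff₀ (by positivity)]
    nlinarith
  have hN1 := hNη.trans (min_le_left _ _)
  have hN2 := hNη.trans (min_le_right _ _)
  have hs : ∀ k q, A k q ≠ 0 → |v m q - δ * (k + 1 - M)| ≤ 2 * δ := by
    intro k q hk
    obtain ⟨h1, h2⟩ := chi_supp (left_ne_zero_of_mul hk)
    have h3 : u q = δ * (w q - M) := by simp only [hw]; field_simp; ring
    have h4 := huv q
    rw [abs_le] at h4 ⊢
    constructor <;> nlinarith
  obtain ⟨V, E, hI, hV, -, hE⟩ := fold hv hb hb1 (s := fun k => δ * (k + 1 - M)) (δ := 2 * δ) (by linarith) sA hs η'0 N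
    (by linarith) N le_rfl
  have hsum : ∀ q, ∑ k ∈ Finset.range N, |A k q| ≤ 2 * |a q| := by
    intro q
    simp only [hA, abs_mul]
    rw [← Finset.sum_mul]
    exact mul_le_mul_of_nonneg_right (chi_abs_sum N (w q)) (abs_nonneg _)
  refine ⟨V, E, hI.congr (fun _ _ => rfl) ?_ (fun _ _ _ => rfl) (by linarith), fun l q => ?_, fun j l q => ?_⟩
  · intro j l q
    congr 1
    have := chi_sum N (w q) (hwb q).1 (hwb q).2
    calc _ = ∑ k ∈ Finset.range N, (chi k (w q) * chi k (w q)) * (a q * a q) :=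
          Finset.sum_congr rfl fun k _ => by simp only [hA]; ring
      _ = _ := by rw [← Finset.sum_mul, this, one_mul]
  · linarith [hV l q, hsum q]
  · have h1 := hE j l q
    have h2 : 6 * (2 * δ) * (∑ k ∈ Finset.range N, |A k q|) ≤ 6 * (2 * δ) * (2 * (Ca + 1)) := by
      have := hsum q
      have := hCa q
      gcongr
      linarith
    nlinarith

end CI

namespace CI
open Set Filter Topology

variable {O : Set ℝ} {f g : STQ → ℝ}

lemma multi {v : Fin 3 → STQ → ℝ} (hv : ∀ l, Good ∅ (v l)) {m : ℕ → Fin 3} {b : ℕ → Fin 3 → ℝ}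
    (hb : ∀ k, b k (m k) = 0) (hb1 : ∀ k i, |b k i| ≤ 1) {a : ℕ → STQ → ℝ} (ha : ∀ k, SB O (a k))
    {η : ℝ} (hη : 0 < η) (n : ℕ) :
    ∃ V E, Inc O v V (fun j l q => ∑ k ∈ Finset.range n, a k q * a k q * (b k j * b k l)) E (n * η) ∧
      (∀ l q, |V l q| ≤ 4 * (∑ k ∈ Finset.range n, |a k q|) + n * η) ∧ (∀ j l q, |E j l q| ≤ n * η) := by
  induction n with
  | zero =>
    refine ⟨fun _ _ => 0, fun _ _ _ => 0, ?_, by simp, by simp⟩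
    exact (Inc.zero v).congr (fun _ _ => rfl) (by simp) (fun _ _ _ => rfl) (by simp)
  | succ n ih =>
    obtain ⟨V, E, hI, hV, hE⟩ := ih
    have hv' : ∀ l, Good ∅ (fun q => v l q + V l q) := fun l => (hv l).add (hI.gV l).e
    obtain ⟨V', E', hI', hV', hE'⟩ := direction hv' (hb n) (hb1 n) (ha n) hη
    have cA : ∀ k, Continuous (a k) := fun k => (ha k).cont
    refine ⟨_, _, (hI.comp hI' (fun l => (hv l).cont) ?_ ?_).congr (fun _ _ => rfl) ?_ (fun _ _ _ => rfl) ?_, ?_, ?_⟩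
    · intro j l; fun_prop
    · intro j l; fun_prop
    · intro j l q; rw [Finset.sum_range_succ]
    · push_cast; linarith
    · intro l q
      rw [Finset.sum_range_succ]
      push_cast
      linarith [abs_add_le (V l q) (V' l q), hV l q, hV' l q]
    · intro j l q
      push_cast
      linarith [abs_add_le (E j l q) (E' j l q), hE j l q, hE' j l q]

def bb : ℕ → Fin 3 → ℝ
  | 0 => ![1, 1, 0]
  | 1 => ![1, -1, 0]
  | 2 => ![1, 0, 1]
  | 3 => ![1, 0, -1]
  | 4 => ![0, 1, 1]
  | 5 => ![0, 1, -1]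
  | _ => ![0, 0, 0]

def mm : ℕ → Fin 3
  | 0 => 2
  | 1 => 2
  | 2 => 1
  | 3 => 1
  | _ => 0

def cc (N : Fin 3 → Fin 3 → ℝ) : ℕ → ℝ
  | 0 => 1 / 4 * (N 0 0 + N 1 1 - N 2 2) + 1 / 2 * N 0 1
  | 1 => 1 / 4 * (N 0 0 + N 1 1 - N 2 2) - 1 / 2 * N 0 1
  | 2 => 1 / 4 * (N 0 0 + N 2 2 - N 1 1) + 1 / 2 * N 0 2
  | 3 => 1 / 4 * (N 0 0 + N 2 2 - N 1 1) - 1 / 2 * N 0 2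
  | 4 => 1 / 4 * (N 1 1 + N 2 2 - N 0 0) + 1 / 2 * N 1 2
  | 5 => 1 / 4 * (N 1 1 + N 2 2 - N 0 0) - 1 / 2 * N 1 2
  | _ => 1 / 12

lemma bb_mm (k : ℕ) : bb k (mm k) = 0 := by
  match k with
  | 0 | 1 | 2 | 3 | 4 | 5 => simp [bb, mm]
  | k + 6 => simp [bb, mm]

lemma bb_le (k : ℕ) (i : Fin 3) : |bb k i| ≤ 1 := by
  match k with
  | 0 | 1 | 2 | 3 | 4 | 5 => fin_cases i <;> simp [bb]
  | k + 6 => fin_cases i <;> simp [bb]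

lemma cc_sum {N : Fin 3 → Fin 3 → ℝ} (h : ∀ j l, N j l = N l j) (j l : Fin 3) :
    ∑ k ∈ Finset.range 6, cc N k * (bb k j * bb k l) = N j l := by
  have h1 := h 1 0
  have h2 := h 2 0
  have h3 := h 2 1
  simp only [Finset.sum_range_succ, Finset.sum_range_zero]
  fin_cases j <;> fin_cases l <;> simp [cc, bb] <;> linarith

lemma cc_near {N : Fin 3 → Fin 3 → ℝ} {s : ℝ} (h : ∀ j l, |N j l - dl j l * (1 / 3)| ≤ s) (k : ℕ) :
    |cc N k - 1 / 12| ≤ 5 / 4 * s := by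
  have h0 := abs_le.1 (h 0 0)
  have h1 := abs_le.1 (h 1 1)
  have h2 := abs_le.1 (h 2 2)
  have h3 := abs_le.1 (h 0 1)
  have h4 := abs_le.1 (h 0 2)
  have h5 := abs_le.1 (h 1 2)
  simp [dl] at h0 h1 h2 h3 h4 h5
  match k with
  | 0 | 1 | 2 | 3 | 4 | 5 => simp only [cc]; rw [abs_le]; constructor <;> linarith
  | k + 6 => simp only [cc]; rw [abs_le]; constructor <;> linarith

lemma cc_SB {N : Fin 3 → Fin 3 → STQ → ℝ} (h : ∀ j l, SB ∅ (N j l)) (k : ℕ) :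
    SB ∅ (fun q => cc (fun j l => N j l q) k) := by
  match k with
  | 0 => exact ((((h 0 0).add (h 1 1)).sub (h 2 2)).cmul _).add ((h 0 1).cmul _)
  | 1 => exact ((((h 0 0).add (h 1 1)).sub (h 2 2)).cmul _).sub ((h 0 1).cmul _)
  | 2 => exact ((((h 0 0).add (h 2 2)).sub (h 1 1)).cmul _).add ((h 0 2).cmul _)
  | 3 => exact ((((h 0 0).add (h 2 2)).sub (h 1 1)).cmul _).sub ((h 0 2).cmul _)
  | 4 => exact ((((h 1 1).add (h 2 2)).sub (h 0 0)).cmul _).add ((h 1 2).cmul _)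
  | 5 => exact ((((h 1 1).add (h 2 2)).sub (h 0 0)).cmul _).sub ((h 1 2).cmul _)
  | k + 6 => exact SB.const _

/-- cutoff of small values -/
def Hc (δ s : ℝ) : ℝ := s * Real.smoothTransition (1 / δ * s - 1)

lemma Hc_smooth (δ : ℝ) : ContDiff ℝ (⊤ : ℕ∞) (Hc δ) :=
  contDiff_id.mul (Real.smoothTransition.contDiff.comp ((contDiff_const.mul contDiff_id).sub contDiff_const))

lemma Hc_zero {δ s : ℝ} (hδ : 0 < δ) (h : s ≤ δ) : Hc δ s = 0 := by
  rw [Hc, Real.smoothTransition.zero_of_nonpos, mul_zero]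
  rw [one_div_mul_eq_div, sub_nonpos, div_le_one hδ]
  exact h

lemma Hc_near {δ s : ℝ} (hδ : 0 < δ) (h : -δ ≤ s) : |Hc δ s - s| ≤ 2 * δ := by
  rcases le_total (2 * δ) s with h1 | h1
  · rw [Hc, Real.smoothTransition.one_of_one_le, mul_one, sub_self, abs_zero]
    · positivity
    · rw [one_div_mul_eq_div, le_sub_iff_add_le, le_div_iff₀ hδ]
      linarith
  · have a1 := Real.smoothTransition.nonneg (1 / δ * s - 1)
    have a2 := Real.smoothTransition.le_one (1 / δ * s - 1)
    have : Hc δ s - s = -(s * (1 - Real.smoothTransition (1 / δ * s - 1))) := by rw [Hc]; ring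
    rw [this, abs_neg, abs_mul]
    have h2 : |s| ≤ 2 * δ := abs_le.2 ⟨by linarith, h1⟩
    have h3 : |1 - Real.smoothTransition (1 / δ * s - 1)| ≤ 1 := abs_le.2 ⟨by linarith, by linarith⟩
    calc _ ≤ 2 * δ * 1 := by gcongr
      _ = _ := mul_one _

lemma core {v : Fin 3 → STQ → ℝ} {R : Fin 3 → Fin 3 → STQ → ℝ} (hv : ∀ l, Good ∅ (v l))
    (hR : ∀ j l, Good ∅ (R j l)) (hsym : ∀ j l q, R j l q = R l j q) {σ : ℝ} (hσ : 0 < σ)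
    (hRb : ∀ j l q, |R j l q| ≤ σ ^ 2) {se : ℝ → ℝ} (hse : Good ∅ (fun q : STQ => se q.1))
    (cse : Continuous se) (se0 : ∀ t, 0 ≤ se t)
    (hdi : ∀ q : STQ, (∀ j l, R j l q = 0) ∨ 10 * σ ≤ se q.1) (hup : ∀ t, se t ≤ 317 * σ)
    {ε : ℝ} (hε : 0 < ε) :
    ∃ (V : Fin 3 → STQ → ℝ) (r : STQ → ℝ) (R₁ : Fin 3 → Fin 3 → STQ → ℝ),
      (∀ l, Good ∅ (V l)) ∧ Good ∅ r ∧ (∀ j l, Good ∅ (R₁ j l)) ∧ (∀ j l q, R₁ j l q = R₁ l j q) ∧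
      (∀ p, Continuous p → WER v p R → WER (fun l q => v l q + V l q) (fun q => p q + r q) R₁) ∧
      (∀ q : STQ, se q.1 = 0 → (∀ l, V l q = 0) ∧ r q = 0 ∧ ∀ j l, R₁ j l q = 0) ∧
      (∀ l q, |V l q| ≤ 100000 * σ) ∧ (∀ q, |r q| ≤ 100000 * σ ^ 2) ∧
      (∀ t, |J (fun q => (∑ i, ((v i q + V i q) ^ 2 - v i q ^ 2)) - se q.1 ^ 2) t| ≤ ε) ∧
      (∀ j l q, |R₁ j l q| ≤ ε) := by
  -- parameters
  set δ : ℝ := min (σ / 3) (ε / (2 * (3 * (700 * σ)))) with hδ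
  have δ0 : 0 < δ := by positivity
  have δ1 : 3 * δ ≤ σ := by have := min_le_left (σ / 3) (ε / (2 * (3 * (700 * σ)))); linarith
  have δ2 : 3 * δ * (700 * σ) ≤ ε / 2 := by
    have := min_le_right (σ / 3) (ε / (2 * (3 * (700 * σ))))
    rw [← hδ, le_div_iff₀ (by positivity)] at this
    linarith
  set δ' : ℝ := min (σ ^ 2 / 20) (ε / 60) with hδ'
  have δ'0 : 0 < δ' := by positivity
  have δ'1 : δ' ≤ σ ^ 2 / 20 := min_le_left _ _
  have δ'2 : δ' ≤ ε / 60 := min_le_right _ _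
  -- amplitude
  obtain ⟨g, sg, hg⟩ := moll hse (by positivity : 0 < δ / 2)
  set E : STQ → ℝ := fun q => Hc δ (g q) with hE
  have sE0 : SB ∅ E := SB.comp (Hc_smooth δ) sg
  have hEs : ∀ q, |E q - se q.1| ≤ 3 * δ := by
    intro q
    have h1 := abs_le.1 (hg q)
    have h2 := Hc_near δ0 (s := g q) (by linarith [se0 q.1])
    have h2 := abs_le.1 h2
    rw [abs_le]
    simp only [hE]
    constructor <;> linarith
  set O : Set ℝ := interior {t | ∀ x, E (t, x) = 0} with hO
  have oO : IsOpen O := isOpen_interior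
  have sE : SB O E := sE0.of_van oO (fun q hq => interior_subset hq q.2)
  have hzO : ∀ t, se t = 0 → t ∈ O := by
    intro t ht
    rw [hO, mem_interior_iff_mem_nhds]
    have : ∀ᶠ s in 𝓝 t, se s < δ / 2 := cse.continuousAt.eventually_lt continuousAt_const (by rw [ht]; positivity)
    filter_upwards [this] with s hs x
    refine Hc_zero δ0 ?_
    have := abs_le.1 (hg (s, x))
    simp only at this
    linarith
  have hEb : ∀ q, |E q| ≤ 318 * σ := by
    intro q
    have h1 := abs_le.1 (hEs q)
    have h2 := se0 q.1
    have h3 := hup q.1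
    rw [abs_le]; constructor <;> linarith
  -- mollified stress
  choose Rm sRm hRm using fun j l => moll (hR j l) δ'0
  set tr : STQ → ℝ := fun q => R 0 0 q + R 1 1 q + R 2 2 q with htr
  have gtr : Good ∅ tr := ((hR 0 0).add (hR 1 1)).add (hR 2 2)
  set trm : STQ → ℝ := fun q => Rm 0 0 q + Rm 1 1 q + Rm 2 2 q with htrm
  have strm : SB ∅ trm := ((sRm 0 0).add (sRm 1 1)).add (sRm 2 2)
  set S : Fin 3 → Fin 3 → STQ → ℝ := fun j l q => 1 / 2 * (Rm j l q + Rm l j q) - dl j l * (1 / 3) * trm q with hS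
  have sS : ∀ j l, SB ∅ (S j l) := fun j l => (((sRm j l).add (sRm l j)).cmul _).sub (strm.cmul _)
  have symS : ∀ j l q, S j l q = S l j q := fun j l q => by simp only [hS]; rw [dl_comm, add_comm]
  set Rc : Fin 3 → Fin 3 → STQ → ℝ := fun j l q => R j l q - dl j l * (1 / 3) * tr q with hRc
  have gRc : ∀ j l, Good ∅ (Rc j l) := fun j l => (hR j l).sub (gtr.cmul _)
  have hdl3 : ∀ (j l : Fin 3) (x y : ℝ), |x| ≤ 3 * y → |dl j l * (1 / 3) * x| ≤ y := by
    intro j l x y h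
    rw [abs_mul, abs_mul, abs_of_pos (by norm_num : (0:ℝ) < 1 / 3)]
    calc _ ≤ 1 * (1 / 3) * (3 * y) := by gcongr; exact dl_abs j l
      _ = y := by ring
  have hSR : ∀ j l q, |S j l q - Rc j l q| ≤ 2 * δ' := by
    intro j l q
    have e1 : S j l q - Rc j l q = (1 / 2 * ((Rm j l q - R j l q) + (Rm l j q - R l j q))) -
        dl j l * (1 / 3) * (trm q - tr q) := by
      simp only [hS, hRc]; rw [hsym l j q]; ring
    have h0 := abs_le.1 (hRm 0 0 q)
    have h1 := abs_le.1 (hRm 1 1 q)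
    have h2 := abs_le.1 (hRm 2 2 q)
    have h3 := abs_le.1 (hRm j l q)
    have h4 := abs_le.1 (hRm l j q)
    have h5 := abs_le.1 (hdl3 j l (trm q - tr q) δ' (by
      simp only [htrm, htr]; rw [abs_le]; constructor <;> linarith))
    rw [e1, abs_le]
    constructor <;> linarith
  have htrb : ∀ q, |tr q| ≤ 3 * σ ^ 2 := by
    intro q
    have h0 := abs_le.1 (hRb 0 0 q)
    have h1 := abs_le.1 (hRb 1 1 q)
    have h2 := abs_le.1 (hRb 2 2 q)
    simp only [htr]; rw [abs_le]; constructor <;> linarith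
  have hRcb : ∀ j l q, |Rc j l q| ≤ 2 * σ ^ 2 := by
    intro j l q
    have h3 := abs_le.1 (hRb j l q)
    have h5 := abs_le.1 (hdl3 j l (tr q) (σ ^ 2) (htrb q))
    simp only [hRc]; rw [abs_le]; constructor <;> linarith
  have hEE : ∀ q, 0 ≤ E q * E q := fun q => mul_self_nonneg _
  have hSb : ∀ j l q, |S j l q| ≤ (E q * E q + ε) / 30 := by
    intro j l q
    have h1 := abs_le.1 (hSR j l q)
    rcases hdi q with h | h
    · have : Rc j l q = 0 := by simp [hRc, htr, h]
      rw [this] at h1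
      have := hEE q
      rw [abs_le]; constructor <;> linarith
    · have h2 := abs_le.1 (hRcb j l q)
      have h3 := abs_le.1 (hEs q)
      have h4 : 9 * σ ≤ E q := by linarith
      have h5 : (9 * σ) * (9 * σ) ≤ E q * E q := mul_self_le_mul_self (by positivity) h4
      rw [abs_le]; constructor <;> nlinarith
  -- weights
  have sEe : SB ∅ (fun q => E q * E q + ε) := (sE0.mul sE0).add (SB.const ε)
  have sI : SB ∅ (fun q => (E q * E q + ε)⁻¹) :=
    SB.comp_pos (G := fun s => s⁻¹) (contDiffOn_id.inv (fun x hx => ne_of_gt hx)) sEe hε (fun q => by linarith [hEE q])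
  have hpos : ∀ q, 0 < E q * E q + ε := fun q => by linarith [hEE q]
  set N : Fin 3 → Fin 3 → STQ → ℝ := fun j l q => dl j l * (1 / 3) - (E q * E q + ε)⁻¹ * S j l q with hN
  have sN : ∀ j l, SB ∅ (N j l) := fun j l => (SB.const _).sub (sI.mul (sS j l))
  have hIS : ∀ j l q, |(E q * E q + ε)⁻¹ * S j l q| ≤ 1 / 30 := by
    intro j l q
    rw [abs_mul, abs_of_pos (inv_pos.2 (hpos q)), inv_mul_le_iff₀ (hpos q)]
    linarith [hSb j l q]
  have hNn : ∀ j l q, |N j l q - dl j l * (1 / 3)| ≤ 1 / 30 := by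
    intro j l q
    have := hIS j l q
    simp only [hN]
    rwa [sub_sub_cancel_left, abs_neg]
  set c : ℕ → STQ → ℝ := fun k q => cc (fun j l => N j l q) k with hc
  have hcn : ∀ k q, 1 / 24 ≤ c k q ∧ c k q ≤ 1 := by
    intro k q
    have := abs_le.1 (cc_near (fun j l => hNn j l q) k)
    simp only [hc]
    constructor <;> linarith
  have ssq : ∀ k, SB ∅ (fun q => Real.sqrt (c k q)) := fun k =>
    SB.comp_pos (G := Real.sqrt) (fun x hx => (Real.contDiffAt_sqrt (ne_of_gt hx)).contDiffWithinAt) (cc_SB sN k)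
      (by norm_num : (0:ℝ) < 1 / 24) (fun q => (hcn k q).1)
  set a : ℕ → STQ → ℝ := fun k q => E q * Real.sqrt (c k q) with ha
  have sa : ∀ k, SB O (a k) := fun k => sE.mul' (ssq k)
  have hab : ∀ k q, |a k q| ≤ 318 * σ := by
    intro k q
    simp only [ha]
    rw [abs_mul, abs_of_nonneg (Real.sqrt_nonneg _)]
    have h1 : Real.sqrt (c k q) ≤ 1 := Real.sqrt_le_one.2 (hcn k q).2
    calc _ ≤ 318 * σ * 1 := by gcongr; exact hEb q
      _ = _ := mul_one _
  set η : ℝ := min (ε / 60) σ with hη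
  have η0 : 0 < η := by positivity
  have η1 : η ≤ ε / 60 := min_le_left _ _
  have η2 : η ≤ σ := min_le_right _ _
  obtain ⟨V, F, hI, hV, hF⟩ := multi hv bb_mm bb_le sa η0 6
  have hB : ∀ j l q, ∑ k ∈ Finset.range 6, a k q * a k q * (bb k j * bb k l) = E q * E q * N j l q := by
    intro j l q
    rw [← cc_sum (N := fun j l => N j l q) (fun j l => by simp only [hN]; rw [dl_comm, symS]) j l, Finset.mul_sum]
    refine Finset.sum_congr rfl fun k _ => ?_
    have : Real.sqrt (c k q) * Real.sqrt (c k q) = c k q := Real.mul_self_sqrt (by linarith [(hcn k q).1])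
    simp only [ha]
    linear_combination (E q * E q * (bb k j * bb k l)) * this
  have hI := hI.congr (fun _ _ => rfl) hB (fun _ _ _ => rfl) le_rfl
  set r : STQ → ℝ := fun q => -(1 / 3) * (E q * E q + tr q) with hr
  set R₁ : Fin 3 → Fin 3 → STQ → ℝ := fun j l q =>
    (Rc j l q - E q * E q * ((E q * E q + ε)⁻¹ * S j l q)) + F j l q with hR₁
  refine ⟨V, r, R₁, fun l => (hI.gV l).e, ((sE0.mul sE0).good.add gtr).cmul _,
    fun j l => ((gRc j l).sub ((sE0.mul sE0).mul (sI.mul (sS j l))).good).add (hI.gE j l).e, ?_, ?_, ?_, ?_, ?_, ?_, ?_⟩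
  · intro j l q
    simp only [hR₁, hRc]
    rw [dl_comm, symS, hsym, hI.sE]
  · intro p cp hw
    refine ((hI.wer p R cp (fun j l => (hR j l).cont) hw).pshift r).congr (fun _ _ => rfl) (fun _ => rfl) ?_
    intro j l q
    simp only [hR₁, hRc, hr, hN]
    ring
  · intro q hq
    have hqO := hzO _ hq
    have hR0 : ∀ j l, R j l q = 0 := by
      rcases hdi q with h | h
      · exact h
      · rw [hq] at h; exfalso; linarith
    have hE0 : E q = 0 := sE.bas.van q hqO
    have htr0 : tr q = 0 := by simp [htr, hR0]
    refine ⟨fun l => (hI.gV l).van q hqO, by simp [hr, hE0, htr0], fun j l => ?_⟩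
    simp [hR₁, hRc, hE0, htr0, hR0, (hI.gE j l).van q hqO]
  · intro l q
    have h1 := hV l q
    have h2 : ∑ k ∈ Finset.range 6, |a k q| ≤ ∑ k ∈ Finset.range 6, 318 * σ :=
      Finset.sum_le_sum fun k _ => hab k q
    simp at h2 h1
    linarith
  · intro q
    have h1 : E q * E q ≤ (318 * σ) * (318 * σ) := by
      rw [← abs_mul_abs_self]
      have := hEb q
      gcongr
    have h2 := abs_le.1 (htrb q)
    have h3 := hEE q
    simp only [hr]
    rw [abs_le]
    constructor <;> nlinarith
  · intro t
    have e1 : (fun q => (∑ i, ((v i q + V i q) ^ 2 - v i q ^ 2)) - se q.1 ^ 2) = fun q =>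
        (∑ i, ((v i q + V i q) ^ 2 - v i q ^ 2 - E q * E q * N i i q)) + (E q * E q - se q.1 ^ 2) := by
      funext q
      have : ∑ i, N i i q = 1 := by
        simp only [hN, hS, htrm, dl_self, Fin.sum_univ_three]; ring
      rw [Fin.sum_univ_three] at this ⊢
      rw [Fin.sum_univ_three]
      linear_combination (E q * E q) * this
    have cv := fun l => (hv l).cont
    have cV := fun l => (hI.gV l).cont
    have cN := fun j l => (sN j l).cont
    have cE := sE0.cont
    rw [e1, J_add (by fun_prop) (by fun_prop)]
    have h1 := hI.en t
    have h2 : |J (fun q => E q * E q - se q.1 ^ 2) t| ≤ ε / 2 := by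
      refine J_bound (fun q => ?_) t
      have : E q * E q - se q.1 ^ 2 = (E q - se q.1) * (E q + se q.1) := by ring
      rw [this, abs_mul]
      refine le_trans ?_ δ2
      have h5 : |E q + se q.1| ≤ 700 * σ := by
        have h3 := abs_le.1 (hEb q)
        have h4 := hup q.1
        have h5 := se0 q.1
        rw [abs_le]; constructor <;> linarith
      have := hEs q
      gcongr
    refine (abs_add_le _ _).trans ?_
    push_cast at h1
    linarith
  · intro j l q
    have h1 : E q * E q * ((E q * E q + ε)⁻¹ * S j l q) = S j l q - ε * ((E q * E q + ε)⁻¹ * S j l q) := by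
      have := (hpos q).ne'
      field_simp
      ring
    have h2 : |ε * ((E q * E q + ε)⁻¹ * S j l q)| ≤ ε * (1 / 30) := by
      rw [abs_mul, abs_of_pos hε]
      gcongr
      exact hIS j l q
    have h2 := abs_le.1 h2
    have h3 := abs_le.1 (hSR j l q)
    have h4 := abs_le.1 (hF j l q)
    simp only [hR₁]
    rw [h1]
    push_cast at h4
    rw [abs_le]
    constructor <;> linarith

end CI

/-- Main Lemma for continuous solutions: one step of the convex integration
iteration, reducing the size of the Reynolds stress to `ε` while adding the
prescribed energy `e(t)`. -/
theorem main_lemma_continuous :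
    ∃ K C : ℝ, 1 ≤ K ∧ 0 < C ∧
      ∀ (ε : ℝ), 0 < ε →
      ∀ (v : ℝ → Spc → Spc) (p : ℝ → Spc → ℝ) (R : ℝ → Spc → Fin 3 → Fin 3 → ℝ),
        (∀ t, Per (v t)) → (∀ t, Per (p t)) → (∀ t, Per (R t)) →
        UniformContinuous (fun q : ℝ × Spc => v q.1 q.2) →
        UniformContinuous (fun q : ℝ × Spc => p q.1 q.2) →
        UniformContinuous (fun q : ℝ × Spc => R q.1 q.2) →
        (∃ B : ℝ, ∀ t x l, |v t x l| ≤ B) →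
        (∀ t x j l, R t x j l = R t x l j) →
        IsWeakEulerReynolds v p R →
      ∀ (I : Set ℝ), (∀ t, t ∉ I → ∀ x, R t x = 0) →
      ∀ (e_R : ℝ), (∀ t x j l, |R t x j l| ≤ e_R) →
      ∀ (e : ℝ → ℝ), (∀ t, 0 ≤ e t) →
        (∃ U : Set ℝ, IsOpen U ∧ I ⊆ U ∧ ∀ t ∈ U, K * e_R ≤ e t) →
        (∀ t, e t ≤ 1000 * K * e_R) →
        Differentiable ℝ (fun t => Real.sqrt (e t)) →
        Continuous (deriv (fun t => Real.sqrt (e t))) →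
        (∃ B : ℝ, ∀ t, |deriv (fun s => Real.sqrt (e s)) t| ≤ B) →
      ∃ (V : ℝ → Spc → Spc) (P : ℝ → Spc → ℝ) (R₁ : ℝ → Spc → Fin 3 → Fin 3 → ℝ),
        (∀ t, Per (V t)) ∧ (∀ t, Per (P t)) ∧ (∀ t, Per (R₁ t)) ∧
        UniformContinuous (fun q : ℝ × Spc => v q.1 q.2 + V q.1 q.2) ∧
        UniformContinuous (fun q : ℝ × Spc => p q.1 q.2 + P q.1 q.2) ∧
        UniformContinuous (fun q : ℝ × Spc => R₁ q.1 q.2) ∧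
        (∀ t x j l, R₁ t x j l = R₁ t x l j) ∧
        IsWeakEulerReynolds (fun t x => v t x + V t x) (fun t x => p t x + P t x) R₁ ∧
        (∀ t, e t = 0 → ∀ x, V t x = 0 ∧ P t x = 0 ∧ R₁ t x = 0) ∧
        (∀ t x l, |V t x l| ≤ C * Real.sqrt e_R) ∧
        (∀ t x, |P t x| ≤ C * e_R) ∧
        (∀ t : ℝ,
          |(∫ x in Tdom, ∑ i, (v t x i + V t x i)^2) -
            (∫ x in Tdom, ((∑ i, (v t x i)^2) + e t))| ≤ ε) ∧
        (∀ t x j l, |R₁ t x j l| ≤ ε) := by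
  refine ⟨100, 100000, by norm_num, by norm_num, ?_⟩
  intro ε hε v p R pv pp pR uv up uR ⟨B, hB⟩ symR hw I hI e_R heR e e0 hU hup hd _ ⟨L, hL⟩
  obtain ⟨U, -, hIU, hUe⟩ := hU
  have heR0 : 0 ≤ e_R := (abs_nonneg _).trans (heR 0 0 0 0)
  rcases heR0.eq_or_lt with h0 | hpos
  · -- trivial case
    subst h0
    have hR0 : ∀ t x, R t x = 0 := fun t x => by
      funext j l
      exact abs_eq_zero.1 (le_antisymm (heR t x j l) (abs_nonneg _))
    have he : ∀ t, e t = 0 := fun t => le_antisymm (by simpa using hup t) (e0 t)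
    refine ⟨fun _ _ => 0, fun _ _ => 0, fun _ _ => 0, fun _ _ _ => rfl, fun _ _ _ => rfl, fun _ _ _ => rfl,
      by simpa using uv, by simpa using up, uniformContinuous_const, fun _ _ _ _ => rfl, ?_, ?_, ?_, ?_, ?_, ?_⟩
    · have : R = fun _ _ => 0 := funext fun t => funext fun x => hR0 t x
      rw [this] at hw
      simpa using hw
    · intro t _ x; exact ⟨rfl, rfl, rfl⟩
    · intro t x l; simp
    · intro t x; simp
    · intro t; simp [he, hε.le]
    · intro t x j l; simp [hε.le]
  · set σ := Real.sqrt e_R with hσ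
    have σ0 : 0 < σ := Real.sqrt_pos.2 hpos
    have σ2 : σ ^ 2 = e_R := Real.sq_sqrt heR0
    set se : ℝ → ℝ := fun t => Real.sqrt (e t) with hse
    have se2 : ∀ t, se t ^ 2 = e t := fun t => Real.sq_sqrt (e0 t)
    have se0 : ∀ t, 0 ≤ se t := fun t => Real.sqrt_nonneg _
    have hseup : ∀ t, se t ≤ 317 * σ := by
      intro t
      refine abs_le_of_sq_le_sq' ?_ (by positivity) |>.2
      rw [se2, mul_pow, σ2]
      linarith [hup t]
    have hL0 : 0 ≤ L := (abs_nonneg _).trans (hL 0)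
    have lip : LipschitzWith ⟨L, hL0⟩ se := by
      refine lipschitzWith_of_nnnorm_deriv_le hd (fun t => ?_)
      exact hL t
    have gse : CI.Good ∅ (fun q : CI.STQ => se q.1) := by
      refine ⟨lip.uniformContinuous.comp uniformContinuous_fst, fun _ _ => rfl, ⟨317 * σ, fun q => ?_⟩, fun q hq => hq.elim⟩
      rw [abs_of_nonneg (se0 _)]; exact hseup _
    have gv : ∀ l, CI.Good ∅ (fun q : CI.STQ => v q.1 q.2 l) := fun l =>
      ⟨uniformContinuous_pi.1 uv l, fun q k => congrFun (pv q.1 q.2 k) l, ⟨B, fun q => hB _ _ _⟩, fun q hq => hq.elim⟩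
    have gR : ∀ j l, CI.Good ∅ (fun q : CI.STQ => R q.1 q.2 j l) := fun j l =>
      ⟨uniformContinuous_pi.1 (uniformContinuous_pi.1 uR j) l, fun q k => congrFun (congrFun (pR q.1 q.2 k) j) l,
        ⟨e_R, fun q => heR _ _ _ _⟩, fun q hq => hq.elim⟩
    have hdi : ∀ q : CI.STQ, (∀ j l, R q.1 q.2 j l = 0) ∨ 10 * σ ≤ se q.1 := by
      intro q
      by_cases hq : q.1 ∈ I
      · right
        refine abs_le_of_sq_le_sq' ?_ (se0 _) |>.2
        rw [se2, mul_pow, σ2]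
        linarith [hUe _ (hIU hq)]
      · left
        intro j l
        rw [hI _ hq]; rfl
    obtain ⟨V, r, R₁, gV, gr, gR₁, symR₁, hwer, hvan, bV, br, hen, bR⟩ :=
      CI.core gv gR (fun j l q => symR _ _ _ _) σ0 (fun j l q => by rw [σ2]; exact heR _ _ _ _) gse
        lip.continuous se0 hdi hseup hε
    refine ⟨fun t x l => V l (t, x), fun t x => r (t, x), fun t x j l => R₁ j l (t, x), ?_, ?_, ?_, ?_, ?_, ?_, ?_, ?_, ?_,
      ?_, ?_, ?_, ?_⟩
    · intro t x k
      funext l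
      exact (gV l).per (t, x) k
    · intro t x k
      exact gr.per (t, x) k
    · intro t x k
      funext j l
      exact (gR₁ j l).per (t, x) k
    · exact uv.add (uniformContinuous_pi.2 fun l => (gV l).uc)
    · exact up.add gr.uc
    · exact uniformContinuous_pi.2 fun j => uniformContinuous_pi.2 fun l => (gR₁ j l).uc
    · intro t x j l
      exact symR₁ j l (t, x)
    · rw [CI.WER_iff] at hw ⊢
      exact hwer _ up.continuous hw
    · intro t ht x
      obtain ⟨h1, h2, h3⟩ := hvan (t, x) (by simp [hse, ht])
      exact ⟨funext h1, h2, funext fun j => funext fun l => h3 j l⟩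
    · intro t x l
      exact bV l (t, x)
    · intro t x
      rw [← σ2]
      exact br (t, x)
    · intro t
      have h := hen t
      have cv := fun l => (gv l).cont
      have cV := fun l => (gV l).cont
      have cse := gse.cont
      have e1 : (fun q : CI.STQ => (∑ i, ((v q.1 q.2 i + V i q) ^ 2 - v q.1 q.2 i ^ 2)) - se q.1 ^ 2) =
          fun q => (∑ i, (v q.1 q.2 i + V i q) ^ 2) - ((∑ i, v q.1 q.2 i ^ 2) + se q.1 ^ 2) := by
        funext q
        rw [Finset.sum_sub_distrib]
        ring
      have c1 : Continuous (fun q : CI.STQ => ∑ i, (v q.1 q.2 i + V i q) ^ 2) :=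
        continuous_finsetSum _ fun i _ => ((cv i).add (cV i)).pow 2
      have c2 : Continuous (fun q : CI.STQ => (∑ i, v q.1 q.2 i ^ 2) + se q.1 ^ 2) :=
        (continuous_finsetSum _ fun i _ => (cv i).pow 2).add (cse.pow 2)
      rw [e1, CI.J_sub c1 c2] at h
      simp only [CI.J, se2] at h
      exact h
    · intro t x j l
      exact bR j l (t, x)
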